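/- (Countable Embedding Absoluteness) Let M and N be transitive sets, with M countable, and let π : M → N be an elementary embedding. Let P be a transitive class with M, N ∈ P such that P satisfies ZF⁻ + DC + 'M is countable'. Then P contains an elementary embedding π* : M → N which agrees with π on any desired finite set and on the critical point of π if it exists. -/

import Mathlib

open FirstOrder FirstOrder.Language

namespace VLC

universe u v

/- ## The language of set theory (with two auxiliary unary predicates) -/

/-- Function symbols: none. -/
inductive Funcs : ℕ → Type
/-- Relation symbols: two unary predicate symbols and one binary (membership) symbol. -/
inductive Rels : ℕ → Type
  | u1 : Rels 1
  | u2 : Rels 1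
  | mem : Rels 2

/-- The first-order language with one binary relation symbol (membership) and two
unary predicate symbols (used for expanded structures `(M, ∈, A, B)`; when a unary
predicate is not needed it is interpreted as the always-false predicate, which does
not change the notion of elementarity). -/
def L3 : Language := ⟨Funcs, Rels⟩

/-- The `L3`-structure on the subclass `{x // dom x}` of a "universe" `V`, with
membership interpreted by `r` and the two unary predicates by `A1`, `A2`. -/
def mstr {V : Type u} (dom : V → Prop) (r : V → V → Prop) (A1 A2 : V → Prop) :
    L3.Structure {x : V // dom x} where
  funMap := fun f _ => nomatch f
  RelMap := fun rel v =>
    match rel with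
    | .u1 => A1 (v 0).1
    | .u2 => A2 (v 0).1
    | .mem => r (v 0).1 (v 1).1

/-- The `L3`-structure on all of `V` with membership `r` (unary predicates empty). -/
def memStr {V : Type u} (r : V → V → Prop) : L3.Structure V where
  funMap := fun f _ => nomatch f
  RelMap := fun rel v =>
    match rel with
    | .u1 => False
    | .u2 => False
    | .mem => r (v 0) (v 1)

/-- An elementary embedding between the structures `({x // domV x}, rV, A1, A2)` and
`({y // domW y}, rW, B1, B2)`: a map preserving the satisfaction of all first-order
formulas of the language of set theory (with two predicates). -/
def ElemEmb {V : Type u} {W : Type v} (domV : V → Prop) (rV : V → V → Prop) (A1 A2 : V → Prop)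
    (domW : W → Prop) (rW : W → W → Prop) (B1 B2 : W → Prop) : Type (max u v) :=
  @ElementaryEmbedding L3 {x : V // domV x} {y : W // domW y}
    (mstr domV rV A1 A2) (mstr domW rW B1 B2)

/-- Application of an elementary embedding. -/
def eApp {V : Type u} {W : Type v} {domV : V → Prop} {rV : V → V → Prop} {A1 A2 : V → Prop}
    {domW : W → Prop} {rW : W → W → Prop} {B1 B2 : W → Prop}
    (e : ElemEmb domV rV A1 A2 domW rW B1 B2) (x : {x : V // domV x}) : {y : W // domW y} :=
  @ElementaryEmbedding.toFun L3 {x : V // domV x} {y : W // domW y}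
    (mstr domV rV A1 A2) (mstr domW rW B1 B2) e x

/-- Realization of a formula with parameters in the full structure `(V, r)`. -/
def RealizeIn {V : Type u} (r : V → V → Prop) {n l : ℕ} (φ : L3.BoundedFormula (Fin n) l)
    (prm : Fin n → V) (xs : Fin l → V) : Prop :=
  @BoundedFormula.Realize L3 V (memStr r) (Fin n) l φ prm xs

/-- Realization of a sentence-with-parameters in the substructure of `(V, r)` on `{x // dom x}`. -/
def RealizeSub {V : Type u} (dom : V → Prop) (r : V → V → Prop) {n l : ℕ}
    (φ : L3.BoundedFormula (Fin n) l) (prm : Fin n → {x : V // dom x})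
    (xs : Fin l → {x : V // dom x}) : Prop :=
  @BoundedFormula.Realize L3 {x : V // dom x} (mstr dom r (fun _ => False) (fun _ => False))
    (Fin n) l φ prm xs

/- ## Basic set-theoretic notions over an abstract membership relation -/

section Basic

variable {V : Type u} (r : V → V → Prop)

/-- `a ⊆ b`. -/
def SubW (a b : V) : Prop := ∀ x, r x a → r x b

/-- `a` is a transitive set. -/
def TransW (a : V) : Prop := ∀ x y, r x a → r y x → r y a

/-- `a` is an ordinal (a transitive set of transitive sets; this is equivalent to the usual
definition in the presence of foundation). -/
def OrdW (a : V) : Prop := TransW r a ∧ ∀ x, r x a → TransW r x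

/-- `a ≤ b` for ordinals: `a ∈ b ∨ a = b`. -/
def ordLe (a b : V) : Prop := r a b ∨ a = b

/-- `p = {a, b}`. -/
def IsUPair (p a b : V) : Prop := ∀ x, r x p ↔ (x = a ∨ x = b)

/-- `p` is the (Kuratowski) ordered pair `⟨a, b⟩`. -/
def IsOPair (p a b : V) : Prop :=
  ∃ sa sab, IsUPair r sa a a ∧ IsUPair r sab a b ∧ IsUPair r p sa sab

/-- The pair `⟨x, y⟩` belongs to `f` (i.e. `f(x) = y` when `f` is a function). -/
def FApp (f x y : V) : Prop := ∃ z, r z f ∧ IsOPair r z x y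

/-- `f` is a function with domain `a`. -/
def IsFunOn (f a : V) : Prop :=
  (∀ z, r z f → ∃ x y, r x a ∧ IsOPair r z x y) ∧
  (∀ x, r x a → ∃ y, FApp r f x y) ∧
  (∀ x y y', FApp r f x y → FApp r f x y' → y = y')

/-- `f : a → b` is a function. -/
def IsFuncW (f a b : V) : Prop := IsFunOn r f a ∧ ∀ x y, FApp r f x y → r y b

/-- `f : a → b` is an injective function. -/
def IsInjW (f a b : V) : Prop :=
  IsFuncW r f a b ∧ ∀ x x' y, FApp r f x y → FApp r f x' y → x = x'

/-- `f : a → b` is a surjective function. -/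
def IsSurjW (f a b : V) : Prop :=
  IsFuncW r f a b ∧ ∀ y, r y b → ∃ x, r x a ∧ FApp r f x y

/-- `a` and `b` are equinumerous. -/
def EquinumW (a b : V) : Prop := ∃ f, IsInjW r f a b ∧ IsSurjW r f a b

/-- `t` is the transitive closure of `x` (the least transitive superset). -/
def TCW (t x : V) : Prop :=
  SubW r x t ∧ TransW r t ∧ ∀ s, SubW r x s → TransW r s → SubW r t s

/-- `|a| < θ` for a cardinal `θ`: `a` injects into some element of `θ`. -/
def CardLtW (a θ : V) : Prop := ∃ β f, r β θ ∧ IsInjW r f a β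

/-- `x ∈ H_θ`: the transitive closure of `x` has cardinality `< θ`. -/
def InHW (θ x : V) : Prop := ∃ t, TCW r t x ∧ CardLtW r t θ

/-- `h = H_θ`, the collection of sets whose transitive closure has size `< θ`. -/
def IsHW (θ h : V) : Prop := ∀ x, r x h ↔ InHW r θ x

/-- `κ` is a cardinal: an ordinal not equinumerous with any of its elements. -/
def IsCardW (κ : V) : Prop := OrdW r κ ∧ ∀ β, r β κ → ¬ EquinumW r β κ

/-- `e = ∅`. -/
def IsEmptyW (e : V) : Prop := ∀ x, ¬ r x e

/-- `s = x ∪ {x}` is the ordinal successor of `x`. -/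
def IsSuccOf (s x : V) : Prop := ∀ z, r z s ↔ (r z x ∨ z = x)

/-- `o` is a limit ordinal. -/
def LimitOrdW (o : V) : Prop := OrdW r o ∧ (∃ x, r x o) ∧ ∀ x, r x o → ∃ y, r y o ∧ r x y

/-- `o = ω`, the least limit ordinal. -/
def IsOmegaW (o : V) : Prop := LimitOrdW r o ∧ ∀ x, r x o → ¬ LimitOrdW r x

/-- `θ` is a regular cardinal: no function from an element of `θ` into `θ` has unbounded range. -/
def RegularW (θ : V) : Prop := IsCardW r θ ∧
  ∀ β f, r β θ → IsFunOn r f β → (∀ x y, FApp r f x y → r y θ) →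
    ∃ γ, r γ θ ∧ ∀ x y, FApp r f x y → r y γ

/-- `θ` is a regular uncountable cardinal. -/
def RegUncW (θ : V) : Prop := RegularW r θ ∧ ∃ o, IsOmegaW r o ∧ r o θ

/-- `θ` is an infinite regular cardinal. -/
def RegularInfW (θ : V) : Prop := RegularW r θ ∧ ∃ o, IsOmegaW r o ∧ ordLe r o θ

/-- `p = 𝒫(x)`. -/
def IsPowW (p x : V) : Prop := ∀ z, r z p ↔ SubW r z x

/-- `θ` is inaccessible: an uncountable regular strong limit cardinal. -/
def InaccW (θ : V) : Prop :=
  RegUncW r θ ∧ ∀ β p, r β θ → IsPowW r p β → CardLtW r p θ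

/-- `s = κ⁺` is the cardinal successor of `κ`. -/
def CardSuccOf (κ s : V) : Prop := IsCardW r s ∧ r κ s ∧ ∀ c, IsCardW r c → r κ c → ordLe r s c

/-- `C` is a club (closed unbounded set) in `δ`. -/
def ClubInW (C δ : V) : Prop :=
  SubW r C δ ∧ (∀ x, r x C → OrdW r x) ∧
  (∀ α, r α δ → ∃ β, r β C ∧ (r α β ∨ α = β)) ∧
  (∀ γ, r γ δ → OrdW r γ → (∃ x, r x γ) →
    (∀ α, r α γ → ∃ β, r β C ∧ r α β ∧ r β γ) → r γ C)

/-- `δ` is a Mahlo cardinal: inaccessible, and every club in `δ` contains a regular cardinal. -/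
def MahloW (δ : V) : Prop :=
  InaccW r δ ∧ ∀ C, ClubInW r C δ → ∃ κ, r κ C ∧ RegularInfW r κ

/-- `g = f ↾ κ` is the restriction of the function `f` to `κ`. -/
def RestrOf (g f κ : V) : Prop :=
  ∀ z, r z g ↔ (r z f ∧ ∃ x y, IsOPair r z x y ∧ r x κ)

/-- `κ` is a closure point of the function `f`: `f '' κ ⊆ κ`. -/
def ClosurePtW (f κ : V) : Prop := ∀ x y, r x κ → FApp r f x y → r y κ

/-- `⟨p, q⟩` belongs to the relation (set of ordered pairs) `rel`. -/
def RelIn (rel p q : V) : Prop := ∃ z, r z rel ∧ IsOPair r z p q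

/-- `a` is countable: `a` injects into `ω`. -/
def CountableW (a : V) : Prop := ∃ o f, IsOmegaW r o ∧ IsInjW r f a o

end Basic

/- ## ZFC universes -/

/-- A universe of ZFC: a (well-founded) type with a membership relation satisfying the ZFC
axioms; the separation and replacement schemas are stated for all first-order formulas
(with parameters) of the language of set theory. Foundation is strengthened to
well-foundedness, i.e. we consider standard models. -/
structure ZFUniv : Type (u + 1) where
  V : Type u
  mem : V → V → Prop
  wf : WellFounded mem
  extensionality : ∀ x y : V, (∀ z, mem z x ↔ mem z y) → x = y
  pairing : ∀ x y : V, ∃ p, IsUPair mem p x y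
  unions : ∀ x : V, ∃ u, ∀ z, mem z u ↔ ∃ y, mem y x ∧ mem z y
  power : ∀ x : V, ∃ p, IsPowW mem p x
  infinity : ∃ o : V, IsOmegaW mem o
  separation : ∀ (n : ℕ) (φ : L3.BoundedFormula (Fin n) 1) (prm : Fin n → V) (a : V),
    ∃ b, ∀ x, mem x b ↔ (mem x a ∧ RealizeIn mem φ prm (fun _ => x))
  replacement : ∀ (n : ℕ) (φ : L3.BoundedFormula (Fin n) 2) (prm : Fin n → V) (a : V),
    (∀ x y y', mem x a → RealizeIn mem φ prm ![x, y] → RealizeIn mem φ prm ![x, y'] → y = y') →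
    ∃ b, ∀ y, mem y b ↔ ∃ x, mem x a ∧ RealizeIn mem φ prm ![x, y]
  choice : ∀ a : V, (∀ x, mem x a → ∃ y, mem y x) →
    ∃ f, IsFunOn mem f a ∧ ∀ x y, mem x a → FApp mem f x y → mem y x

/- ## Set-forcing extensions -/

/-- A set-forcing extension of the universe `u`: a universe `W` together with an
inclusion of `u` as a transitive subclass, a forcing poset `pos` (with preorder `lerel`,
a set of ordered pairs, where `RelIn lerel p q` means `p` is stronger than `q`)
belonging to `u`, a filter `G ⊆ pos` meeting every dense subset of `pos` that belongs
to `u`, such that `G ∈ W` and every element of `W` is the value `val τ` of some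
`pos`-name `τ ∈ u`, where names are evaluated by `G` in the standard recursive fashion.
This pins `W` down as the generic extension `u[G]`. -/
structure Extension (u : ZFUniv.{u}) : Type (u + 1) where
  W : ZFUniv.{u}
  inc : u.V → W.V
  inc_inj : Function.Injective inc
  inc_mem : ∀ x y, W.mem (inc x) (inc y) ↔ u.mem x y
  inc_trans : ∀ (x : u.V) (w : W.V), W.mem w (inc x) → ∃ y, u.mem y x ∧ w = inc y
  pos : u.V
  lerel : u.V
  le_pairs : ∀ z, u.mem z lerel → ∃ p q, u.mem p pos ∧ u.mem q pos ∧ IsOPair u.mem z p q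
  le_refl : ∀ p, u.mem p pos → RelIn u.mem lerel p p
  le_trans : ∀ p q s, RelIn u.mem lerel p q → RelIn u.mem lerel q s → RelIn u.mem lerel p s
  G : u.V → Prop
  G_sub : ∀ p, G p → u.mem p pos
  G_ne : ∃ p, G p
  G_up : ∀ p q, G p → u.mem q pos → RelIn u.mem lerel p q → G q
  G_dir : ∀ p q, G p → G q → ∃ s, G s ∧ RelIn u.mem lerel s p ∧ RelIn u.mem lerel s q
  G_gen : ∀ D, (∀ d, u.mem d D → u.mem d pos) →
    (∀ p, u.mem p pos → ∃ d, u.mem d D ∧ RelIn u.mem lerel d p) → ∃ p, G p ∧ u.mem p D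
  Gset : W.V
  Gset_spec : ∀ w, W.mem w Gset ↔ ∃ p, G p ∧ w = inc p
  val : u.V → W.V
  val_spec : ∀ τ w, W.mem w (val τ) ↔
    ∃ σ p z, u.mem z τ ∧ IsOPair u.mem z σ p ∧ G p ∧ w = val σ
  val_surj : ∀ w, ∃ τ, w = val τ

/- ## Generic elementary embeddings -/

/-- A generic elementary embedding from the structure `(h, ∈, A1, A2)`, where `h` is a set
of the universe `u`, to a structure `(tgt, ∈, bset, b2)` living in some set-forcing
extension of `u`: the embedding is an element (`code`) of the extension `E.W`, and `emb`
is its externalization, an elementary embedding in the model-theoretic sense. -/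
structure GenEmb (u : ZFUniv.{u}) (h : u.V) (A1 A2 : u.V → Prop) : Type (u + 1) where
  E : Extension u
  tgt : E.W.V
  bset : E.W.V
  b2 : E.W.V → Prop := fun _ => False
  emb : ElemEmb (u.mem · h) u.mem A1 A2 (E.W.mem · tgt) E.W.mem (E.W.mem · bset) b2
  code : E.W.V
  code_fun : IsFuncW E.W.mem code (E.inc h) tgt
  code_graph : ∀ x (hx : u.mem x h), FApp E.W.mem code (E.inc x) (eApp emb ⟨x, hx⟩).1

namespace GenEmb

variable {u : ZFUniv.{u}} {h : u.V} {A1 A2 : u.V → Prop} (D : GenEmb u h A1 A2)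

/-- The critical point of the embedding is `κ`: `κ` is an ordinal, all ordinals below `κ`
are fixed, and `κ` is moved. -/
def crit (κ : u.V) : Prop :=
  OrdW u.mem κ ∧ ∃ hκ : u.mem κ h,
    (∀ α (hα : u.mem α h), u.mem α κ → (eApp D.emb ⟨α, hα⟩).1 = D.E.inc α) ∧
    (eApp D.emb ⟨κ, hκ⟩).1 ≠ D.E.inc κ

/-- `π(x) = y` where `y` is (the copy of) a set of the ground universe. -/
def mapsTo (x y : u.V) : Prop := ∃ hx : u.mem x h, (eApp D.emb ⟨x, hx⟩).1 = D.E.inc y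

/-- `π(κ) > θ`. -/
def jGT (κ θ : u.V) : Prop := ∃ hκ : u.mem κ h, D.E.W.mem (D.E.inc θ) (eApp D.emb ⟨κ, hκ⟩).1

/-- `π(κ) ≤ θ`. -/
def jLE (κ θ : u.V) : Prop := ∃ hκ : u.mem κ h, ordLe D.E.W.mem (eApp D.emb ⟨κ, hκ⟩).1 (D.E.inc θ)

/-- `H_θ ⊆ N`, i.e. the domain `h` is contained in the target. -/
def hSub : Prop := ∀ x, u.mem x h → D.E.W.mem (D.E.inc x) D.tgt

/-- The target is a transitive set (of the extension). -/
def tgtTrans : Prop := TransW D.E.W.mem D.tgt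

/-- The target is (the copy of) the ground-universe set `N`; in particular `N ⊆ V`. -/
def tgtIs (N : u.V) : Prop := D.tgt = D.E.inc N

/-- `B ∩ h = A` where `B` is the predicate of the target structure. -/
def bMatch (A : u.V → Prop) : Prop :=
  ∀ x, u.mem x h → (D.E.W.mem (D.E.inc x) D.bset ↔ A x)

/-- The target is closed under `<θ`-sequences from the ground universe: every function
in `u` from an ordinal `γ < θ` into the target belongs to the target. -/
def closedLt (θ : u.V) : Prop := ∀ s γ, u.mem γ θ → OrdW u.mem γ → IsFunOn u.mem s γ →
  (∀ x y, FApp u.mem s x y → D.E.W.mem (D.E.inc y) D.tgt) → D.E.W.mem (D.E.inc s) D.tgt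

/-- The embedding is `κ`-powerset preserving: its domain and target have the same subsets
of `κ` (in the extension). -/
def powerPres (κ : u.V) : Prop :=
  ∀ w, SubW D.E.W.mem w (D.E.inc κ) → (D.E.W.mem w (D.E.inc h) ↔ D.E.W.mem w D.tgt)

/-- `H_θ = H_θ^N` : the domain `h = H_θ` coincides with `H_θ` as computed inside the
(possibly generic) transitive target `N = tgt`, namely the collection of `x ∈ N` having,
in `N`, a transitive closure `t` and an injection of `t` into some `β ∈ θ`. -/
def hEqHtgt (θ : u.V) : Prop :=
  ∀ w, D.E.W.mem w (D.E.inc h) ↔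
    (D.E.W.mem w D.tgt ∧ ∃ t f β, D.E.W.mem t D.tgt ∧ TCW D.E.W.mem t w ∧
      D.E.W.mem β (D.E.inc θ) ∧ D.E.W.mem f D.tgt ∧ IsInjW D.E.W.mem f t β)

end GenEmb

/-- A generic elementary embedding of plain ∈-structures (no predicates). -/
abbrev PlainEmb (u : ZFUniv.{u}) (h : u.V) : Type (u + 1) :=
  GenEmb u h (fun _ => False) (fun _ => False)


section Notions

variable (u : ZFUniv.{u})

/- ### Measurable / strong / supercompact family -/

/-- `κ` is faintly `θ`-measurable: in a forcing extension there are a transitive set `N`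
and an elementary embedding `π : H_θ → N` with critical point `κ`. -/
def FaintMeasAt (θ κ : u.V) : Prop := ∃ h, IsHW u.mem θ h ∧
  ∃ D : PlainEmb u h, D.tgtTrans ∧ D.crit κ

/-- `κ` is virtually `θ`-measurable: moreover `N ⊆ V` (the target is a set of the ground
universe). -/
def VirtMeasAt (θ κ : u.V) : Prop := ∃ h, IsHW u.mem θ h ∧
  ∃ (N : u.V) (D : PlainEmb u h), D.tgtIs N ∧ TransW u.mem N ∧ D.crit κ

/-- `κ` is faintly `θ`-pre-strong: faintly `θ`-measurable with `H_θ ⊆ N`. -/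
def FaintPreStrongAt (θ κ : u.V) : Prop := ∃ h, IsHW u.mem θ h ∧
  ∃ D : PlainEmb u h, D.tgtTrans ∧ D.crit κ ∧ D.hSub

/-- `κ` is faintly `θ`-strong: faintly `θ`-pre-strong with `π(κ) > θ`. -/
def FaintStrongAt (θ κ : u.V) : Prop := ∃ h, IsHW u.mem θ h ∧
  ∃ D : PlainEmb u h, D.tgtTrans ∧ D.crit κ ∧ D.hSub ∧ D.jGT κ θ

/-- `κ` is virtually `θ`-pre-strong: `N ⊆ V`, `H_θ ⊆ N`, `crit π = κ`. -/
def VirtPreStrongAt (θ κ : u.V) : Prop := ∃ h, IsHW u.mem θ h ∧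
  ∃ (N : u.V) (D : PlainEmb u h), D.tgtIs N ∧ TransW u.mem N ∧ D.crit κ ∧ D.hSub

/-- `κ` is virtually `θ`-strong: virtually `θ`-pre-strong with `π(κ) > θ`. -/
def VirtStrongAt (θ κ : u.V) : Prop := ∃ h, IsHW u.mem θ h ∧
  ∃ (N : u.V) (D : PlainEmb u h), D.tgtIs N ∧ TransW u.mem N ∧ D.crit κ ∧ D.hSub ∧ D.jGT κ θ

/-- `κ` is virtually `θ`-supercompact: virtually `θ`-measurable with target closed under
`<θ`-sequences from the ground universe and `π(κ) > θ`. -/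
def VirtSupercompactAt (θ κ : u.V) : Prop := ∃ h, IsHW u.mem θ h ∧
  ∃ (N : u.V) (D : PlainEmb u h), D.tgtIs N ∧ TransW u.mem N ∧ D.crit κ ∧
    D.closedLt θ ∧ D.jGT κ θ

/-- `κ` is virtually `θ`-supercompact ala Magidor: there are `κ̄ < θ̄ < κ` and a generic
elementary embedding `π : H_θ̄ → H_θ` with `crit π = κ̄` and `π(κ̄) = κ`. -/
def VirtMagidorAt (θ κ : u.V) : Prop := ∃ κ' θ', u.mem κ' θ' ∧ u.mem θ' κ ∧
  ∃ h' h, IsHW u.mem θ' h' ∧ IsHW u.mem θ h ∧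
    ∃ D : PlainEmb u h', D.tgtIs h ∧ D.crit κ' ∧ D.mapsTo κ' κ

/-- `κ` is virtually strong: virtually `θ`-strong for all regular (uncountable) `θ > κ`. -/
def VirtStrong (κ : u.V) : Prop := ∀ θ, RegUncW u.mem θ → u.mem κ θ → VirtStrongAt u θ κ

/-- `κ` is virtually supercompact. -/
def VirtSupercompact (κ : u.V) : Prop :=
  ∀ θ, RegUncW u.mem θ → u.mem κ θ → VirtSupercompactAt u θ κ

/-- `κ` is virtually supercompact ala Magidor. -/
def VirtMagidor (κ : u.V) : Prop := ∀ θ, RegUncW u.mem θ → u.mem κ θ → VirtMagidorAt u θ κ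

/-- `κ` is virtually pre-strong. -/
def VirtPreStrong (κ : u.V) : Prop := ∀ θ, RegUncW u.mem θ → u.mem κ θ → VirtPreStrongAt u θ κ

/- ### Power(set-preserving) variants -/

/-- `κ` is faintly power-`θ`-measurable: the generic embedding is moreover
`κ`-powerset preserving. -/
def FaintPowerMeasAt (θ κ : u.V) : Prop := ∃ h, IsHW u.mem θ h ∧
  ∃ D : PlainEmb u h, D.tgtTrans ∧ D.crit κ ∧ D.powerPres κ

/-- `κ` is faintly power-`θ`-pre-strong. -/
def FaintPowerPreStrongAt (θ κ : u.V) : Prop := ∃ h, IsHW u.mem θ h ∧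
  ∃ D : PlainEmb u h, D.tgtTrans ∧ D.crit κ ∧ D.hSub ∧ D.powerPres κ

/-- `κ` is faintly power-`θ`-strong. -/
def FaintPowerStrongAt (θ κ : u.V) : Prop := ∃ h, IsHW u.mem θ h ∧
  ∃ D : PlainEmb u h, D.tgtTrans ∧ D.crit κ ∧ D.hSub ∧ D.jGT κ θ ∧ D.powerPres κ

/- ### Superstrong / rank-into-rank family -/

/-- `κ` is virtually `(θ,1)`-superstrong: as virtually `θ`-pre-strong, with `π(κ) ≤ θ`. -/
def VirtSuperstrong1At (θ κ : u.V) : Prop := ∃ h, IsHW u.mem θ h ∧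
  ∃ (N : u.V) (D : PlainEmb u h), D.tgtIs N ∧ TransW u.mem N ∧ D.crit κ ∧ D.hSub ∧ D.jLE κ θ

/-- `κ` is faintly `(θ,1)`-superstrong. -/
def FaintSuperstrong1At (θ κ : u.V) : Prop := ∃ h, IsHW u.mem θ h ∧
  ∃ D : PlainEmb u h, D.tgtTrans ∧ D.crit κ ∧ D.hSub ∧ D.jLE κ θ

/-- `κ` is faintly superstrong: faintly `(θ,1)`-superstrong for some regular uncountable
`θ > κ`. -/
def FaintSuperstrong (κ : u.V) : Prop :=
  ∃ θ, RegUncW u.mem θ ∧ u.mem κ θ ∧ FaintSuperstrong1At u θ κ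

/-- `κ` is virtually `(θ,ω)`-superstrong: as virtually `θ`-pre-strong, together with the
full critical sequence `κ = π⁰(κ), π¹(κ), π²(κ), …` satisfying `πⁿ(κ) < θ` for all `n`
(equivalently `π^ω(κ) = sup_n πⁿ(κ) ≤ θ`). -/
def VirtOmegaSuperstrongAt (θ κ : u.V) : Prop := ∃ h, IsHW u.mem θ h ∧
  ∃ (N : u.V) (D : PlainEmb u h), D.tgtIs N ∧ TransW u.mem N ∧ D.crit κ ∧ D.hSub ∧
    ∃ c : ℕ → u.V, c 0 = κ ∧ ∀ n, u.mem (c n) θ ∧ D.mapsTo (c n) (c (n + 1))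

/-- `κ` is virtually rank-into-rank: there is a cardinal `θ > κ` and a generic elementary
embedding `π : H_θ → H_θ` with `crit π = κ`. -/
def VirtRankToRank (κ : u.V) : Prop := ∃ θ h, IsCardW u.mem θ ∧ u.mem κ θ ∧ IsHW u.mem θ h ∧
  ∃ D : PlainEmb u h, D.tgtIs h ∧ D.crit κ

/- ### (θ, A)-strong family (for a set `A`) and Woodin cardinals -/

/-- `κ` is virtually `(θ, A)`-strong (`A` a set of the ground universe): there is a generic
elementary embedding `π : (H_θ, ∈, A ∩ H_θ) → (N, ∈, B)` with `N` transitive, `N ⊆ V`,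
`crit π = κ`, `π(κ) > θ`, `H_θ ⊆ N` and `B ∩ H_θ = A ∩ H_θ`. -/
def VirtAStrongAt (θ κ A : u.V) : Prop := ∃ h, IsHW u.mem θ h ∧
  ∃ (N : u.V) (D : GenEmb u h (u.mem · A) (fun _ => False)), D.tgtIs N ∧ TransW u.mem N ∧
    D.crit κ ∧ D.jGT κ θ ∧ D.hSub ∧ D.bMatch (u.mem · A)

/-- `κ` is faintly `(θ, A)`-strong: as above but `N` is merely a transitive set of the
extension. -/
def FaintAStrongAt (θ κ A : u.V) : Prop := ∃ h, IsHW u.mem θ h ∧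
  ∃ D : GenEmb u h (u.mem · A) (fun _ => False), D.tgtTrans ∧
    D.crit κ ∧ D.jGT κ θ ∧ D.hSub ∧ D.bMatch (u.mem · A)

/-- `κ` is virtually `(θ, A)`-supercompact: moreover the target is closed under
`<θ`-sequences from the ground universe. -/
def VirtASupercompactAt (θ κ A : u.V) : Prop := ∃ h, IsHW u.mem θ h ∧
  ∃ (N : u.V) (D : GenEmb u h (u.mem · A) (fun _ => False)), D.tgtIs N ∧ TransW u.mem N ∧
    D.crit κ ∧ D.jGT κ θ ∧ D.hSub ∧ D.bMatch (u.mem · A) ∧ D.closedLt θ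

/-- `κ` is virtually `(θ, A)`-extendible: moreover the target is `H_μ` for some cardinal
`μ` of the ground universe. -/
def VirtAExtendibleAt (θ κ A : u.V) : Prop := ∃ h, IsHW u.mem θ h ∧
  ∃ (N : u.V) (D : GenEmb u h (u.mem · A) (fun _ => False)), D.tgtIs N ∧ TransW u.mem N ∧
    D.crit κ ∧ D.jGT κ θ ∧ D.hSub ∧ D.bMatch (u.mem · A) ∧
    ∃ μ, IsCardW u.mem μ ∧ IsHW u.mem μ N

/-- The weakening of virtual `(θ, A)`-strongness in which `N ⊆ V` is replaced by
`H_θ = H_θ^N`. -/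
def WeakAStrongAt (θ κ A : u.V) : Prop := ∃ h, IsHW u.mem θ h ∧
  ∃ D : GenEmb u h (u.mem · A) (fun _ => False), D.tgtTrans ∧
    D.crit κ ∧ D.jGT κ θ ∧ D.hEqHtgt θ ∧ D.bMatch (u.mem · A)

/-- `κ` is virtually `(<δ, A)`-strong: virtually `(θ, A ∩ H_θ)`-strong for all regular
(uncountable) `θ` with `κ < θ < δ`. -/
def VirtLtAStrong (δ κ A : u.V) : Prop :=
  ∀ θ, RegUncW u.mem θ → u.mem κ θ → u.mem θ δ → VirtAStrongAt u θ κ A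

/-- `κ` is faintly `(<δ, A)`-strong. -/
def FaintLtAStrong (δ κ A : u.V) : Prop :=
  ∀ θ, RegUncW u.mem θ → u.mem κ θ → u.mem θ δ → FaintAStrongAt u θ κ A

/-- `κ` is virtually `(<δ, A)`-supercompact. -/
def VirtLtASupercompact (δ κ A : u.V) : Prop :=
  ∀ θ, RegUncW u.mem θ → u.mem κ θ → u.mem θ δ → VirtASupercompactAt u θ κ A

/-- `κ` is virtually `(<δ, A)`-extendible. -/
def VirtLtAExtendible (δ κ A : u.V) : Prop :=
  ∀ θ, RegUncW u.mem θ → u.mem κ θ → u.mem θ δ → VirtAExtendibleAt u θ κ A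

/-- `δ` is virtually Woodin: for every `A ⊆ H_δ` there is a virtually `(<δ, A)`-strong
cardinal `κ < δ`. -/
def VirtWoodin (δ : u.V) : Prop := ∀ A, (∀ x, u.mem x A → InHW u.mem δ x) →
  ∃ κ, u.mem κ δ ∧ VirtLtAStrong u δ κ A

/-- `δ` is faintly Woodin. -/
def FaintWoodin (δ : u.V) : Prop := ∀ A, (∀ x, u.mem x A → InHW u.mem δ x) →
  ∃ κ, u.mem κ δ ∧ FaintLtAStrong u δ κ A

/- ### Class (`On`) versions, for GBC statements; classes are predicates on the universe -/

/-- `κ` is virtually `(θ, A)`-pre-strong for a class `A`. -/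
def VirtClassPreStrongAt (θ κ : u.V) (A : u.V → Prop) : Prop := ∃ h, IsHW u.mem θ h ∧
  ∃ (N : u.V) (D : GenEmb u h A (fun _ => False)), D.tgtIs N ∧ TransW u.mem N ∧
    D.crit κ ∧ D.hSub ∧ D.bMatch A

/-- `κ` is virtually `(θ, A)`-strong for a class `A`. -/
def VirtClassStrongAt (θ κ : u.V) (A : u.V → Prop) : Prop := ∃ h, IsHW u.mem θ h ∧
  ∃ (N : u.V) (D : GenEmb u h A (fun _ => False)), D.tgtIs N ∧ TransW u.mem N ∧
    D.crit κ ∧ D.jGT κ θ ∧ D.hSub ∧ D.bMatch A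

/-- `κ` is faintly `(θ, A)`-pre-strong for a class `A`. -/
def FaintClassPreStrongAt (θ κ : u.V) (A : u.V → Prop) : Prop := ∃ h, IsHW u.mem θ h ∧
  ∃ D : GenEmb u h A (fun _ => False), D.tgtTrans ∧ D.crit κ ∧ D.hSub ∧ D.bMatch A

/-- `On` is virtually pre-Woodin: for every class `A` there is a cardinal `κ` which is
virtually `(θ, A)`-pre-strong for all regular `θ > κ`. -/
def OnVirtPreWoodin : Prop := ∀ A : u.V → Prop, ∃ κ, IsCardW u.mem κ ∧
  ∀ θ, RegUncW u.mem θ → u.mem κ θ → VirtClassPreStrongAt u θ κ A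

/-- `On` is faintly pre-Woodin. -/
def OnFaintPreWoodin : Prop := ∀ A : u.V → Prop, ∃ κ, IsCardW u.mem κ ∧
  ∀ θ, RegUncW u.mem θ → u.mem κ θ → FaintClassPreStrongAt u θ κ A

/-- `On` is virtually Woodin. -/
def OnVirtWoodin : Prop := ∀ A : u.V → Prop, ∃ κ, IsCardW u.mem κ ∧
  ∀ θ, RegUncW u.mem θ → u.mem κ θ → VirtClassStrongAt u θ κ A

/- ### Berkeley cardinals -/

/-- `δ` is virtually proto-Berkeley: for every transitive set `M ⊇ δ` there is a generic
elementary embedding `π : M → M` with `crit π < δ`. -/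
def VirtProtoBerkeley (δ : u.V) : Prop := ∀ M, TransW u.mem M → SubW u.mem δ M →
  ∃ (D : PlainEmb u M) (κ : u.V), D.tgtIs M ∧ D.crit κ ∧ u.mem κ δ

/-- `δ` is virtually Berkeley: for every transitive set `M ⊇ δ` and every `η < δ` there is
a generic elementary embedding `π : M → M` with `η < crit π < δ`. -/
def VirtBerkeley (δ : u.V) : Prop := ∀ M, TransW u.mem M → SubW u.mem δ M → ∀ η, u.mem η δ →
  ∃ (D : PlainEmb u M) (κ : u.V), D.tgtIs M ∧ D.crit κ ∧ u.mem η κ ∧ u.mem κ δ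

/-- `δ` is virtually club Berkeley: for every transitive set `M ⊇ δ` and every club
`C ⊆ δ` there is a generic elementary embedding `π : M → M` with `crit π ∈ C`. -/
def VirtClubBerkeley (δ : u.V) : Prop := ∀ M, TransW u.mem M → SubW u.mem δ M →
  ∀ C, ClubInW u.mem C δ →
    ∃ (D : PlainEmb u M) (κ : u.V), D.tgtIs M ∧ D.crit κ ∧ u.mem κ C

/- ### The virtual Vopěnka principle -/

/-- `m` is (an ordered pair coding) a first-order structure with universe `a` and binary
relation `rel` (structures in an arbitrary common language are rendered, by the standard
coding, as structures with a single binary relation). -/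
def GraphStr (m a rel : u.V) : Prop := IsOPair u.mem m a rel ∧
  ∀ z, u.mem z rel → ∃ x y, u.mem x a ∧ u.mem y a ∧ IsOPair u.mem z x y

/-- `C` is a proper class (not included in any set). -/
def ProperClass (C : u.V → Prop) : Prop := ¬ ∃ s, ∀ m, C m → u.mem m s

end Notions

/-- A generic elementary embedding between two structures `(a, rel)` and `(a', rel')` of
the ground universe `u`, existing in (i.e. coded by an element of) a set-forcing
extension of `u`. -/
structure GenGraphEmb (u : ZFUniv.{u}) (a rel a' rel' : u.V) : Type (u + 1) where
  E : Extension u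
  emb : ElemEmb (u.mem · a) (RelIn u.mem rel) (fun _ => False) (fun _ => False)
    (E.W.mem · (E.inc a')) (RelIn E.W.mem (E.inc rel')) (fun _ => False) (fun _ => False)
  code : E.W.V
  code_fun : IsFuncW E.W.mem code (E.inc a) (E.inc a')
  code_graph : ∀ x (hx : u.mem x a), FApp E.W.mem code (E.inc x) (eApp emb ⟨x, hx⟩).1

/-- The virtual Vopěnka Principle: for every (proper) class `C` of structures in a common
language there are distinct `m, m' ∈ C` with a generic elementary embedding from `m`
to `m'`. -/
def VirtVP (u : ZFUniv.{u}) : Prop := ∀ C : u.V → Prop,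
  (∀ m, C m → ∃ a rel, GraphStr u m a rel) → ProperClass u C →
  ∃ m m' a rel a' rel', C m ∧ C m' ∧ m ≠ m' ∧ GraphStr u m a rel ∧ GraphStr u m' a' rel' ∧
    Nonempty (GenGraphEmb u a rel a' rel')

/- ### The cumulative hierarchy, natural sequences and the Vopěnka filter -/

/-- `IsVrank u α v` says `v = V_α`, the `α`-th level of the cumulative hierarchy
(`V_α = ⋃_{β ∈ α} 𝒫(V_β)`), defined by well-founded recursion. -/
def IsVrank (u : ZFUniv.{u}) : u.V → u.V → Prop :=
  u.wf.fix (C := fun _ => u.V → Prop)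
    (fun α ih v => ∀ x, u.mem x v ↔ ∃ β, ∃ hβ : u.mem β α, ∃ w, ih β hβ w ∧ SubW u.mem x w)

/-- A natural `On`-sequence of structures `M_α = (V_{f(α)}, ∈, {α}, R_α)`, given by an
indexing (class) function `f = F` and (class-many) unary relations `R_α ⊆ V_{f(α)}`;
`Vr α` realizes the level `V_{f(α)}`. -/
structure NatSeq (u : ZFUniv.{u}) : Type (u + 1) where
  F : u.V → u.V
  R : u.V → u.V
  Vr : u.V → u.V
  F_ord : ∀ α, OrdW u.mem α → OrdW u.mem (F α)
  F_gt : ∀ α, OrdW u.mem α → u.mem α (F α)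
  F_mono : ∀ α β, OrdW u.mem β → u.mem α β → ordLe u.mem (F α) (F β)
  Vr_spec : ∀ α, OrdW u.mem α → IsVrank u (F α) (Vr α)
  R_sub : ∀ α, OrdW u.mem α → SubW u.mem (R α) (Vr α)

/-- A generic elementary embedding `M_α → M_β` between two structures of a natural
sequence, where `M_α = (V_{f(α)}, ∈, R_α, {α})`. -/
structure GenNatEmb (u : ZFUniv.{u}) (S : NatSeq u) (α β : u.V) : Type (u + 1) where
  E : Extension u
  emb : ElemEmb (u.mem · (S.Vr α)) u.mem (u.mem · (S.R α)) (· = α)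
    (E.W.mem · (E.inc (S.Vr β))) E.W.mem (E.W.mem · (E.inc (S.R β))) (· = E.inc β)
  code : E.W.V
  code_fun : IsFuncW E.W.mem code (E.inc (S.Vr α)) (E.inc (S.Vr β))
  code_graph : ∀ x (hx : u.mem x (S.Vr α)), FApp E.W.mem code (E.inc x) (eApp emb ⟨x, hx⟩).1

/-- The critical point of a generic embedding between members of a natural sequence. -/
def GenNatEmb.crit {u : ZFUniv.{u}} {S : NatSeq u} {α β : u.V} (D : GenNatEmb u S α β)
    (κ : u.V) : Prop :=
  OrdW u.mem κ ∧ ∃ hκ : u.mem κ (S.Vr α),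
    (∀ γ (hγ : u.mem γ (S.Vr α)), u.mem γ κ → (eApp D.emb ⟨γ, hγ⟩).1 = D.E.inc γ) ∧
    (eApp D.emb ⟨κ, hκ⟩).1 ≠ D.E.inc κ

/-- The class `X` belongs to the virtual Vopěnka filter on `On`: there is a natural
sequence such that the critical point of any generic elementary embedding `M_α → M_β`
(`α < β`) lies in `X`. -/
def InVopFilter (u : ZFUniv.{u}) (X : u.V → Prop) : Prop := ∃ S : NatSeq u,
  ∀ α β, OrdW u.mem α → OrdW u.mem β → u.mem α β →
    ∀ (D : GenNatEmb u S α β) (κ : u.V), D.crit κ → X κ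

/-- `C` is a class club of ordinals. -/
def ClassClub (u : ZFUniv.{u}) (C : u.V → Prop) : Prop := (∀ x, C x → OrdW u.mem x) ∧
  (∀ α, OrdW u.mem α → ∃ β, C β ∧ u.mem α β) ∧
  (∀ γ, OrdW u.mem γ → (∃ x, u.mem x γ) →
    (∀ α, u.mem α γ → ∃ β, C β ∧ u.mem α β ∧ u.mem β γ) → C γ)

/-- `On` is Mahlo: every class club of ordinals contains a regular cardinal. -/
def OnMahlo (u : ZFUniv.{u}) : Prop :=
  ∀ C : u.V → Prop, ClassClub u C → ∃ κ, C κ ∧ RegularInfW u.mem κ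

/- ### The constructible universe -/

/-- `x` is a definable (with parameters) subset of the structure `(m, ∈)`. -/
def DefOverSet (u : ZFUniv.{u}) (m x : u.V) : Prop := SubW u.mem x m ∧
  ∃ (n : ℕ) (φ : L3.BoundedFormula (Fin n) 1) (prm : Fin n → {y : u.V // u.mem y m}),
    ∀ y (hy : u.mem y m),
      u.mem y x ↔ RealizeSub (u.mem · m) u.mem φ prm (fun _ => ⟨y, hy⟩)

/-- `IsL u α ℓ` says `ℓ = L_α`, the `α`-th level of Gödel's constructible hierarchy
(`L_α = ⋃_{β ∈ α} Def(L_β)`), defined by well-founded recursion. -/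
def IsL (u : ZFUniv.{u}) : u.V → u.V → Prop :=
  u.wf.fix (C := fun _ => u.V → Prop)
    (fun α ih ℓ => ∀ x, u.mem x ℓ ↔ ∃ β, ∃ hβ : u.mem β α, ∃ ℓβ, ih β hβ ℓβ ∧ DefOverSet u ℓβ x)

/-- The constructible universe `L` of `u`, as a class. -/
def ClassL (u : ZFUniv.{u}) (x : u.V) : Prop := ∃ α ℓ, OrdW u.mem α ∧ IsL u α ℓ ∧ u.mem x ℓ

/-- The universe `u` satisfies `V = L`. -/
def VeqL (u : ZFUniv.{u}) : Prop := ∀ x, ClassL u x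

end VLC

namespace VLC

/-- `(P, r)` is a model of `ZF⁻ + DC`: ZF without the powerset axiom, with the collection
scheme in place of the replacement scheme, together with the principle of dependent
choices. (Foundation is inherited from the ambient universe for transitive classes.) -/
structure IsZFminusDC {P : Type u} (r : P → P → Prop) : Prop where
  extensionality : ∀ x y, (∀ z, r z x ↔ r z y) → x = y
  foundation : ∀ x, (∃ y, r y x) → ∃ y, r y x ∧ ∀ z, r z y → ¬ r z x
  pairing : ∀ x y, ∃ p, IsUPair r p x y
  unions : ∀ x, ∃ w, ∀ z, r z w ↔ ∃ y, r y x ∧ r z y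
  infinity : ∃ o, IsOmegaW r o
  separation : ∀ (n : ℕ) (φ : L3.BoundedFormula (Fin n) 1) (prm : Fin n → P) (a : P),
    ∃ b, ∀ x, r x b ↔ (r x a ∧ RealizeIn r φ prm (fun _ => x))
  collection : ∀ (n : ℕ) (φ : L3.BoundedFormula (Fin n) 2) (prm : Fin n → P) (a : P),
    (∀ x, r x a → ∃ y, RealizeIn r φ prm ![x, y]) →
    ∃ b, ∀ x, r x a → ∃ y, r y b ∧ RealizeIn r φ prm ![x, y]
  dc : ∀ a rel x0, r x0 a → (∀ z, r z rel → ∃ x y, IsOPair r z x y) →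
    (∀ x, r x a → ∃ y, r y a ∧ RelIn r rel x y) →
    ∃ o f, IsOmegaW r o ∧ IsFuncW r f o a ∧
      (∀ e, IsEmptyW r e → FApp r f e x0) ∧
      (∀ n s y y', r n o → IsSuccOf r s n → FApp r f n y → FApp r f s y' → RelIn r rel y y')

section Definability

variable {Q : Type u} {r : Q → Q → Prop}

/-- A term over the valuations `α → Q`: a variable or a constant. -/
class IsTermFn {α : Type} (t : (α → Q) → Q) : Prop where
  out : ∃ s : Q ⊕ α, ∀ v, t v = Sum.elim id v s

instance IsTermFn.var {α : Type} (a : α) : IsTermFn (fun v : α → Q => v a) :=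
  ⟨Sum.inr a, fun _ => rfl⟩

instance IsTermFn.const {α : Type} (c : Q) : IsTermFn (fun _ : α → Q => c) :=
  ⟨Sum.inl c, fun _ => rfl⟩

instance IsTermFn.comp {α β : Type} (t : (α → Q) → Q) (g : α → β) [ht : IsTermFn t] :
    IsTermFn (fun v : β → Q => t (fun a => v (g a))) := by
  obtain ⟨s, hs⟩ := ht.out
  refine ⟨s.map id g, fun v => ?_⟩
  rw [hs]
  cases s <;> rfl

/-- A predicate on valuations `α → Q` is definable over `(Q, r)` with parameters. -/
class Dfn (r : Q → Q → Prop) {α : Type} (S : (α → Q) → Prop) : Prop where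
  out : ∃ φ : L3.Formula (Q ⊕ α), ∀ v, @Formula.Realize L3 Q (memStr r) _ φ (Sum.elim id v) ↔ S v

namespace Dfn

variable {α : Type}

instance mem (t s : (α → Q) → Q) [ht : IsTermFn t] [hs : IsTermFn s] :
    Dfn r (fun v => r (t v) (s v)) := by
  obtain ⟨a, ha⟩ := ht.out
  obtain ⟨b, hb⟩ := hs.out
  let _ := memStr r
  refine ⟨Relations.formula₂ (L := L3) (show L3.Relations 2 from Rels.mem)
    (Term.var a) (Term.var b), fun v => ?_⟩
  refine Formula.realize_rel₂.trans ?_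
  rw [ha, hb]
  rfl

instance eq (t s : (α → Q) → Q) [ht : IsTermFn t] [hs : IsTermFn s] :
    Dfn r (fun v => t v = s v) := by
  obtain ⟨a, ha⟩ := ht.out
  obtain ⟨b, hb⟩ := hs.out
  let _ := memStr r
  refine ⟨Term.equal (L := L3) (Term.var a) (Term.var b), fun v => ?_⟩
  rw [Formula.realize_equal, ha, hb]
  rfl

instance imp (S T : (α → Q) → Prop) [hS : Dfn r S] [hT : Dfn r T] :
    Dfn r (fun v => S v → T v) := by
  obtain ⟨φ, hφ⟩ := hS.out
  obtain ⟨ψ, hψ⟩ := hT.out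
  let _ := memStr r
  exact ⟨φ.imp ψ, fun v => by rw [Formula.realize_imp, hφ, hψ]⟩

instance not (S : (α → Q) → Prop) [hS : Dfn r S] : Dfn r (fun v => ¬ S v) := by
  obtain ⟨φ, hφ⟩ := hS.out
  let _ := memStr r
  exact ⟨φ.not, fun v => by rw [Formula.realize_not, hφ]⟩

instance and (S T : (α → Q) → Prop) [hS : Dfn r S] [hT : Dfn r T] :
    Dfn r (fun v => S v ∧ T v) := by
  obtain ⟨φ, hφ⟩ := hS.out
  obtain ⟨ψ, hψ⟩ := hT.out
  let _ := memStr r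
  exact ⟨φ ⊓ ψ, fun v => by rw [Formula.realize_inf, hφ, hψ]⟩

instance or (S T : (α → Q) → Prop) [hS : Dfn r S] [hT : Dfn r T] :
    Dfn r (fun v => S v ∨ T v) := by
  have : (fun v => S v ∨ T v) = fun v => ¬ S v → T v := by
    funext v; exact propext or_iff_not_imp_left
  rw [this]
  infer_instance

instance iff (S T : (α → Q) → Prop) [hS : Dfn r S] [hT : Dfn r T] :
    Dfn r (fun v => S v ↔ T v) := by
  have : (fun v => S v ↔ T v) = fun v => (S v → T v) ∧ (T v → S v) := by
    funext v; exact propext iff_iff_implies_and_implies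
  rw [this]
  infer_instance

instance all (S : (α → Q) → Q → Prop)
    [hS : Dfn r (fun v : Option α → Q => S (fun a => v (some a)) (v none))] :
    Dfn r (fun v => ∀ x, S v x) := by
  obtain ⟨φ, hφ⟩ := hS.out
  let _ := memStr r
  let g : Q ⊕ Option α → (Q ⊕ α) ⊕ Unit := Sum.elim (fun q => .inl (.inl q))
    (fun o => o.elim (.inr ()) (fun a => .inl (.inr a)))
  refine ⟨(φ.relabel g).iAlls Unit, fun v => ?_⟩
  rw [Formula.realize_iAlls]
  have key : ∀ x : Q, (φ.relabel g).Realize (Sum.elim (Sum.elim id v) fun _ : Unit => x) ↔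
      S v x := by
    intro x
    refine Formula.realize_relabel.trans (Iff.trans ?_ (hφ fun o => o.elim x v))
    refine iff_of_eq (congrArg _ ?_)
    funext a
    rcases a with q | _ | a <;> rfl
  exact ⟨fun h x => (key x).1 (h fun _ => x), fun h i => (key (i ())).2 (h _)⟩

instance ex (S : (α → Q) → Q → Prop)
    [hS : Dfn r (fun v : Option α → Q => S (fun a => v (some a)) (v none))] :
    Dfn r (fun v => ∃ x, S v x) := by
  have : (fun v => ∃ x, S v x) = fun v => ¬ ∀ x, ¬ S v x := by
    funext v; simp
  rw [this]
  infer_instance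

/-- A definable predicate is definable by a formula with finitely many parameters. -/
theorem exists_finite_params {S : (α → Q) → Prop} (h : Dfn r S) :
    ∃ (n : ℕ) (prm : Fin n → Q) (φ : L3.Formula (Fin n ⊕ α)),
      ∀ v, @Formula.Realize L3 Q (memStr r) _ φ (Sum.elim prm v) ↔ S v := by
  classical
  obtain ⟨φ, hφ⟩ := h.out
  let _ := memStr r
  let s : Finset Q := φ.freeVarFinset.toLeft
  let e := s.equivFin
  let f : φ.freeVarFinset → Fin s.card ⊕ α := fun x => match x with
    | ⟨.inl q, hq⟩ => .inl (e ⟨q, Finset.mem_toLeft.2 hq⟩)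
    | ⟨.inr a, _⟩ => .inr a
  refine ⟨s.card, fun i => (e.symm i).1, BoundedFormula.restrictFreeVar φ f, fun v => ?_⟩
  rw [← hφ]
  refine BoundedFormula.realize_restrictFreeVar _ ?_
  rintro ⟨q | a, hq⟩
  · simp [f]
  · simp [f]

instance isUPair (p a b : (α → Q) → Q) [IsTermFn p] [IsTermFn a] [IsTermFn b] :
    Dfn r (fun v => IsUPair r (p v) (a v) (b v)) := by
  unfold IsUPair
  infer_instance

instance isOPair (p a b : (α → Q) → Q) [IsTermFn p] [IsTermFn a] [IsTermFn b] :
    Dfn r (fun v => IsOPair r (p v) (a v) (b v)) := by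
  unfold IsOPair
  infer_instance

instance fApp (p a b : (α → Q) → Q) [IsTermFn p] [IsTermFn a] [IsTermFn b] :
    Dfn r (fun v => FApp r (p v) (a v) (b v)) := by
  unfold FApp
  infer_instance

instance subW (a b : (α → Q) → Q) [IsTermFn a] [IsTermFn b] :
    Dfn r (fun v => SubW r (a v) (b v)) := by
  unfold SubW
  infer_instance

end Dfn

namespace IsZFminusDC

variable (h : IsZFminusDC r)
include h

/-- Separation for predicates definable with parameters. -/
theorem sep (a : Q) (S : Q → Prop) [hS : Dfn r (fun v : Unit → Q => S (v ()))] :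
    ∃ b, ∀ x, r x b ↔ r x a ∧ S x := by
  obtain ⟨n, prm, φ, hφ⟩ := hS.exists_finite_params
  obtain ⟨b, hb⟩ := h.separation n
    (BoundedFormula.relabel (Sum.map id (fun _ : Unit => (0 : Fin 1))) φ) prm a
  refine ⟨b, fun x => (hb x).trans (and_congr_right fun _ => ?_)⟩
  rw [← hφ fun _ => x]
  let _ := memStr r
  unfold RealizeIn
  rw [BoundedFormula.realize_relabel, Formula.Realize]
  refine iff_of_eq ?_
  congr 1
  · funext i
    rcases i with i | i <;> rfl
  · funext i
    exact i.elim0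

/-- Collection for relations definable with parameters. -/
theorem coll (a : Q) (S : Q → Q → Prop) [hS : Dfn r (fun v : Bool → Q => S (v false) (v true))]
    (H : ∀ x, r x a → ∃ y, S x y) : ∃ b, ∀ x, r x a → ∃ y, r y b ∧ S x y := by
  obtain ⟨n, prm, φ, hφ⟩ := hS.exists_finite_params
  let ψ : L3.BoundedFormula (Fin n) 2 :=
    BoundedFormula.relabel (Sum.map id (fun c : Bool => if c then (1 : Fin 2) else 0)) φ
  have key : ∀ x y, RealizeIn r ψ prm ![x, y] ↔ S x y := by
    intro x y
    refine Iff.trans ?_ (hφ fun c => if c then y else x)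
    let _ := memStr r
    unfold RealizeIn
    rw [BoundedFormula.realize_relabel, Formula.Realize]
    refine iff_of_eq ?_
    congr 1
    · funext i
      rcases i with i | (_ | _) <;> rfl
    · funext i
      exact i.elim0
  obtain ⟨b, hb⟩ := h.collection n ψ prm a (fun x hx => (H x hx).imp fun y => (key x y).2)
  exact ⟨b, fun x hx => (hb x hx).imp fun y hy => ⟨hy.1, (key x y).1 hy.2⟩⟩

end IsZFminusDC
end Definability

section Definability
variable {Q : Type u} {r : Q → Q → Prop}

/-- A binary predicate is definable over `(Q, r)` with parameters. -/
class Dfn₂ (r : Q → Q → Prop) (S : Q → Q → Prop) : Prop where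
  out : ∀ {α : Type} (a b : (α → Q) → Q) [IsTermFn a] [IsTermFn b],
    Dfn r (fun v => S (a v) (b v))

/-- A ternary predicate is definable over `(Q, r)` with parameters. -/
class Dfn₃ (r : Q → Q → Prop) (S : Q → Q → Q → Prop) : Prop where
  out : ∀ {α : Type} (a b c : (α → Q) → Q) [IsTermFn a] [IsTermFn b] [IsTermFn c],
    Dfn r (fun v => S (a v) (b v) (c v))

end Definability

section Ordinals

variable {V : Type u} {r : V → V → Prop} (wf : WellFounded r)

theorem OrdW.of_mem {a b : V} (ha : OrdW r a) (hb : r b a) : OrdW r b :=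
  ⟨ha.2 b hb, fun x hx => ha.2 x (ha.1 b x hb hx)⟩

include wf in
theorem OrdW.trichotomy (ext : ∀ x y : V, (∀ z, r z x ↔ r z y) → x = y) :
    ∀ a b : V, OrdW r a → OrdW r b → r a b ∨ a = b ∨ r b a := by
  intro a
  induction a using wf.induction with
  | _ a iha =>
  intro b
  induction b using wf.induction with
  | _ b ihb =>
  intro ha hb
  by_contra! hne
  obtain ⟨h1, h2, h3⟩ := hne
  refine h2 (ext a b fun z => ⟨fun hz => ?_, fun hz => ?_⟩)
  · rcases iha z hz b (ha.of_mem hz) hb with h | rfl | h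
    · exact h
    · exact absurd hz h3
    · exact absurd (ha.1 z b hz h) h3
  · rcases ihb z hz ha (hb.of_mem hz) with h | rfl | h
    · exact absurd (hb.1 z a hz h) h1
    · exact absurd hz h1
    · exact h

include wf in
theorem IsOmegaW.unique (ext : ∀ x y : V, (∀ z, r z x ↔ r z y) → x = y) {a b : V}
    (ha : IsOmegaW r a) (hb : IsOmegaW r b) : a = b := by
  rcases OrdW.trichotomy wf ext a b ha.1.1 hb.1.1 with h | h | h
  · exact absurd ha.1 (hb.2 a h)
  · exact h
  · exact absurd hb.1 (ha.2 b h)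

include wf in
theorem IsOmegaW.empty_or_succ (ext : ∀ x y : V, (∀ z, r z x ↔ r z y) → x = y) {o n : V}
    (ho : IsOmegaW r o) (hn : r n o) :
    IsEmptyW r n ∨ ∃ m, r m o ∧ r m n ∧ IsSuccOf r n m := by
  by_contra! hne
  obtain ⟨h1, h2⟩ := hne
  have hnO := ho.1.1.of_mem hn
  refine ho.2 n hn ⟨hnO, by simpa [IsEmptyW] using h1, fun x hx => ?_⟩
  by_contra! h3
  refine h2 x (ho.1.1.1 n x hn hx) hx fun z => ⟨fun hz => ?_, ?_⟩
  · rcases OrdW.trichotomy wf ext z x (hnO.of_mem hz) (hnO.of_mem hx) with h | h | h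
    · exact Or.inl h
    · exact Or.inr h
    · exact absurd h (h3 z hz)
  · rintro (h | rfl)
    · exact hnO.1 x z hx h
    · exact hx

end Ordinals

section Pairs

variable {V : Type u} {r : V → V → Prop}

theorem IsUPair.unique (ext : ∀ x y : V, (∀ z, r z x ↔ r z y) → x = y) {p q a b : V}
    (hp : IsUPair r p a b) (hq : IsUPair r q a b) : p = q :=
  ext _ _ fun z => (hp z).trans (hq z).symm

theorem IsOPair.unique (ext : ∀ x y : V, (∀ z, r z x ↔ r z y) → x = y) {p q a b : V}
    (hp : IsOPair r p a b) (hq : IsOPair r q a b) : p = q := by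
  obtain ⟨s, t, hs, ht, hp⟩ := hp
  obtain ⟨s', t', hs', ht', hq⟩ := hq
  obtain rfl := hs.unique ext hs'
  obtain rfl := ht.unique ext ht'
  exact hp.unique ext hq

theorem IsOPair.inj (ext : ∀ x y : V, (∀ z, r z x ↔ r z y) → x = y) {p a b a' b' : V}
    (hp : IsOPair r p a b) (hq : IsOPair r p a' b') : a = a' ∧ b = b' := by
  obtain ⟨s, t, hs, ht, hp⟩ := hp
  obtain ⟨s', t', hs', ht', hq⟩ := hq
  have e1 : s = s' ∨ s = t' := (hq s).1 ((hp s).2 (Or.inl rfl))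
  have e2 : t = s' ∨ t = t' := (hq t).1 ((hp t).2 (Or.inr rfl))
  have e4 : t' = s ∨ t' = t := (hp t').1 ((hq t').2 (Or.inr rfl))
  have ha : a = a' := by
    rcases e1 with rfl | rfl
    · simpa using (hs' a).1 ((hs a).2 (Or.inl rfl))
    · exact (by simpa using (hs a').1 ((ht' a').2 (Or.inl rfl)) : a' = a).symm
  subst ha
  obtain rfl := hs.unique ext hs'
  refine ⟨rfl, ?_⟩
  have b1 := (ht b).2 (Or.inr rfl)
  have b2 := (ht' b').2 (Or.inr rfl)
  have f1 : ∀ x, r x s → x = a := fun x hx => by simpa using (hs x).1 hx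
  rcases e2 with rfl | rfl
  · rcases e4 with rfl | rfl
    · rw [f1 b b1, f1 b' b2]
    · rw [f1 b b1, f1 b' b2]
  · rcases (ht' b).1 b1 with rfl | h
    · rcases (ht b').1 b2 with h | h <;> exact h.symm
    · exact h

end Pairs

/-- `q = p ∪ {⟨a, b⟩}`. -/
def AddPair {V : Type u} (r : V → V → Prop) (q p a b : V) : Prop :=
  ∀ z, r z q ↔ (r z p ∨ IsOPair r z a b)

instance Dfn.addPair {Q : Type u} {r : Q → Q → Prop} {α : Type} (q p a b : (α → Q) → Q)
    [IsTermFn q] [IsTermFn p] [IsTermFn a] [IsTermFn b] :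
    Dfn r (fun v => AddPair r (q v) (p v) (a v) (b v)) := by
  unfold AddPair
  infer_instance

theorem FApp.mono {V : Type u} {r : V → V → Prop} {R R' x y : V} (h : FApp r R x y)
    (hs : SubW r R R') : FApp r R' x y :=
  h.imp fun z hz => ⟨hs z hz.1, hz.2⟩

namespace IsZFminusDC

variable {Q : Type u} {r : Q → Q → Prop} (h : IsZFminusDC r)
include h

theorem exists_oPair (x y : Q) : ∃ p, IsOPair r p x y := by
  obtain ⟨s, hs⟩ := h.pairing x x
  obtain ⟨t, ht⟩ := h.pairing x y
  obtain ⟨p, hp⟩ := h.pairing s t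
  exact ⟨p, s, t, hs, ht, hp⟩

theorem exists_union (x y : Q) : ∃ w, ∀ z, r z w ↔ r z x ∨ r z y := by
  obtain ⟨p, hp⟩ := h.pairing x y
  obtain ⟨w, hw⟩ := h.unions p
  refine ⟨w, fun z => (hw z).trans ?_⟩
  simp [hp _]

theorem exists_insert (x y : Q) : ∃ w, ∀ z, r z w ↔ r z x ∨ z = y := by
  obtain ⟨p, hp⟩ := h.pairing y y
  obtain ⟨w, hw⟩ := h.exists_union x p
  exact ⟨w, fun z => by rw [hw, hp, or_self]⟩

theorem exists_addPair (p a b : Q) : ∃ q, AddPair r q p a b := by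
  obtain ⟨c, hc⟩ := h.exists_oPair a b
  obtain ⟨q, hq⟩ := h.exists_insert p c
  refine ⟨q, fun z => (hq z).trans (or_congr_right ⟨?_, fun hz => hz.unique h.extensionality hc⟩)⟩
  rintro rfl
  exact hc

theorem exists_empty : ∃ e : Q, IsEmptyW r e := by
  obtain ⟨o, -⟩ := h.infinity
  obtain ⟨e, he⟩ := h.sep o (fun x => ¬ x = x)
  exact ⟨e, fun x hx => ((he x).1 hx).2 rfl⟩

/-- The coordinates of the pairs in `R` form a set. -/
theorem exists_coords (R : Q) : ∃ T, ∀ x y, FApp r R x y → r x T ∧ r y T := by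
  obtain ⟨U, hU⟩ := h.unions R
  obtain ⟨T, hT⟩ := h.unions U
  refine ⟨T, ?_⟩
  rintro x y ⟨z, hz, s, t, hs, ht, hst⟩
  have htU : r t U := (hU t).2 ⟨z, hz, (hst t).2 (Or.inr rfl)⟩
  exact ⟨(hT x).2 ⟨t, htU, (ht x).2 (Or.inl rfl)⟩, (hT y).2 ⟨t, htU, (ht y).2 (Or.inr rfl)⟩⟩

end IsZFminusDC

section

variable {Q : Type u} {r : Q → Q → Prop}

theorem AddPair.fApp (h : IsZFminusDC r) {q p a b : Q} (hq : AddPair r q p a b) :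
    FApp r q a b := by
  obtain ⟨c, hc⟩ := h.exists_oPair a b
  exact ⟨c, (hq c).2 (Or.inr hc), hc⟩

theorem AddPair.subW {q p a b : Q} (hq : AddPair r q p a b) : SubW r p q :=
  fun z hz => (hq z).2 (Or.inl hz)

theorem AddPair.fApp_iff (h : IsZFminusDC r) {q p a b : Q} (hq : AddPair r q p a b)
    {x y : Q} : FApp r q x y ↔ FApp r p x y ∨ (x = a ∧ y = b) := by
  constructor
  · rintro ⟨z, hz, hxy⟩
    rcases (hq z).1 hz with h' | h'
    · exact Or.inl ⟨z, h', hxy⟩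
    · exact Or.inr (hxy.inj h.extensionality h')
  · rintro (h' | ⟨rfl, rfl⟩)
    · exact h'.mono hq.subW
    · exact hq.fApp h

end

/-- `R` is a certificate for `Θ`: each pair `⟨k, p⟩` in `R` satisfies the condition `Θ k p R`. -/
def Cert {V : Type u} (r : V → V → Prop) (Θ : V → V → V → Prop) (R : V) : Prop :=
  ∀ k p, FApp r R k p → Θ k p R

instance Dfn.cert {Q : Type u} {r : Q → Q → Prop} (Θ : Q → Q → Q → Prop) [hΘ : Dfn₃ r Θ]
    {α : Type} (R : (α → Q) → Q) [IsTermFn R] : Dfn r (fun v => Cert r Θ (R v)) := by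
  have := @hΘ.out
  unfold Cert
  infer_instance

/-- A predicate is monotone (with respect to inclusion) in its set argument. -/
def MonoW {V : Type u} (r : V → V → Prop) (Ψ : V → Prop) : Prop :=
  ∀ R R', Ψ R → SubW r R R' → Ψ R'

namespace IsZFminusDC

variable {Q : Type u} {r : Q → Q → Prop} (h : IsZFminusDC r)
  {Θ : Q → Q → Q → Prop} (mono : ∀ k p, MonoW r (Θ k p))
include h mono

theorem cert_insert {R k p : Q} (hR : Cert r Θ R) (hk : Θ k p R) :
    ∃ R', Cert r Θ R' ∧ SubW r R R' ∧ FApp r R' k p := by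
  obtain ⟨R', hR'⟩ := h.exists_addPair R k p
  refine ⟨R', fun k' p' hk' => ?_, hR'.subW, hR'.fApp h⟩
  rcases (hR'.fApp_iff h).1 hk' with h' | ⟨rfl, rfl⟩
  · exact mono _ _ _ _ (hR _ _ h') hR'.subW
  · exact mono _ _ _ _ hk hR'.subW

theorem cert_union {R S : Q} (hR : Cert r Θ R) (hS : Cert r Θ S) :
    ∃ U, Cert r Θ U ∧ SubW r R U ∧ SubW r S U := by
  obtain ⟨U, hU⟩ := h.exists_union R S
  have h1 : SubW r R U := fun z hz => (hU z).2 (Or.inl hz)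
  have h2 : SubW r S U := fun z hz => (hU z).2 (Or.inr hz)
  refine ⟨U, ?_, h1, h2⟩
  rintro k p ⟨z, hz, hkp⟩
  rcases (hU z).1 hz with h' | h'
  · exact mono _ _ _ _ (hR k p ⟨z, h', hkp⟩) h1
  · exact mono _ _ _ _ (hS k p ⟨z, h', hkp⟩) h2

/-- Certificates for the members of a set can be amalgamated into a single certificate. -/
theorem cert_uniform [Dfn₃ r Θ] (I : Q) (Ψ : Q → Q → Prop) [hΨ : Dfn₂ r Ψ]
    (mΨ : ∀ i, MonoW r (Ψ i)) (H : ∀ i, r i I → ∃ R, Cert r Θ R ∧ Ψ i R) :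
    ∃ R, Cert r Θ R ∧ ∀ i, r i I → Ψ i R := by
  have := @hΨ.out
  obtain ⟨B, hB⟩ := h.coll I (fun i R => Cert r Θ R ∧ Ψ i R) H
  obtain ⟨B', hB'⟩ := h.sep B (fun R => Cert r Θ R)
  obtain ⟨U, hU⟩ := h.unions B'
  have hsub : ∀ R, r R B' → SubW r R U := fun R hR z hz => (hU z).2 ⟨R, hR, hz⟩
  refine ⟨U, ?_, fun i hi => ?_⟩
  · rintro k p ⟨z, hz, hkp⟩
    obtain ⟨R, hR, hzR⟩ := (hU z).1 hz
    exact mono _ _ _ _ (((hB' R).1 hR).2 k p ⟨z, hzR, hkp⟩) (hsub R hR)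
  · obtain ⟨R, hR, hRc, hRi⟩ := hB i hi
    exact mΨ i _ _ hRi (hsub R ((hB' R).2 ⟨hR, hRc⟩))

end IsZFminusDC

namespace IsZFminusDC

variable {Q : Type u} {r : Q → Q → Prop} (h : IsZFminusDC r)
include h

theorem exists_prod (X Y : Q) :
    ∃ W, ∀ z x y, r x X → r y Y → IsOPair r z x y → r z W := by
  obtain ⟨B, hB⟩ := h.coll X (fun x W => ∀ y, r y Y → ∀ z, IsOPair r z x y → r z W)
    (fun x _ => by
      obtain ⟨W, hW⟩ := h.coll Y (fun y z => IsOPair r z x y) (fun y _ => h.exists_oPair x y)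
      refine ⟨W, fun y hy z hz => ?_⟩
      obtain ⟨z', hz', hp⟩ := hW y hy
      rwa [hz.unique h.extensionality hp])
  obtain ⟨U, hU⟩ := h.unions B
  refine ⟨U, fun z x y hx hy hz => ?_⟩
  obtain ⟨W, hW, hxW⟩ := hB x hx
  exact (hU z).2 ⟨W, hW, hxW y hy z hz⟩

/-- A tree relation on the set `F` which has a branch in the universe through `p₀` has an
internal branch through `p₀`. -/
theorem exists_branch (wf : WellFounded r) (Ch : Q → Q → Prop) [hCh : Dfn₂ r Ch] (F : Q)
    (hF : ∀ p q, Ch p q → r q F) (Tr : Q → Prop) (p₀ : Q) (hTr₀ : Tr p₀) (hp₀ : r p₀ F)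
    (hTr : ∀ p, Tr p → ∃ q, Ch p q ∧ Tr q) :
    ∃ o g, IsOmegaW r o ∧ IsFuncW r g o F ∧ (∀ e, IsEmptyW r e → FApp r g e p₀) ∧
      ∀ n s y y', r n o → IsSuccOf r s n → FApp r g n y → FApp r g s y' → Ch y y' := by
  have := @hCh.out
  let Θ : Q → Q → Q → Prop := fun x p R => ∀ q, Ch p q → ∃ y, r y x ∧ FApp r R y q
  have hΘ : Dfn₃ r Θ := ⟨by intros; dsimp only [Θ]; infer_instance⟩
  have mono : ∀ k p, MonoW r (Θ k p) := fun k p R R' hR hs q hq =>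
    (hR q hq).imp fun y hy => ⟨hy.1, hy.2.mono hs⟩
  have bad : ∀ R, Cert r Θ R → ∀ x p, Tr p → ¬ FApp r R x p := by
    intro R hR x
    induction x using wf.induction with
    | _ x ih =>
    intro p hp hx
    obtain ⟨q, hq, hqT⟩ := hTr p hp
    obtain ⟨y, hy, hyq⟩ := hR x p hx q hq
    exact ih y hy q hqT hyq
  let Good : Q → Prop := fun p => ∃ R x, Cert r Θ R ∧ FApp r R x p
  have good_of : ∀ p, (∀ q, Ch p q → Good q) → Good p := by
    intro p hp
    obtain ⟨I, hI⟩ := h.sep F (fun q => Ch p q)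
    obtain ⟨R, hR, hRI⟩ := h.cert_uniform mono I (fun q R => ∃ x, FApp r R x q)
      (hΨ := ⟨by intros; infer_instance⟩)
      (fun q R R' hR hs => hR.imp fun x hx => hx.mono hs)
      (fun q hq => by
        obtain ⟨R, x, hR, hx⟩ := hp q ((hI q).1 hq).2
        exact ⟨R, hR, x, hx⟩)
    obtain ⟨T, hT⟩ := h.exists_coords R
    obtain ⟨R', hR', -, hk⟩ := h.cert_insert mono (k := T) (p := p) hR fun q hq => by
      obtain ⟨x, hx⟩ := hRI q ((hI q).2 ⟨hF p q hq, hq⟩)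
      exact ⟨x, (hT x q hx).1, hx⟩
    exact ⟨R', T, hR', hk⟩
  obtain ⟨a, ha⟩ := h.sep F (fun p => ¬ ∃ R x, Cert r Θ R ∧ FApp r R x p)
  obtain ⟨W, hW⟩ := h.exists_prod F F
  obtain ⟨rel, hrel⟩ := h.sep W (fun z => ∃ p q, IsOPair r z p q ∧ Ch p q)
  have hrel' : ∀ p q, RelIn r rel p q → Ch p q := by
    rintro p q ⟨z, hz, hpq⟩
    obtain ⟨p', q', hpq', hc⟩ := ((hrel z).1 hz).2
    obtain ⟨rfl, rfl⟩ := hpq.inj h.extensionality hpq'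
    exact hc
  obtain ⟨o, g, ho, hg, hg₀, hgs⟩ := h.dc a rel p₀
    ((ha p₀).2 ⟨hp₀, fun ⟨R, x, hR, hx⟩ => bad R hR x p₀ hTr₀ hx⟩)
    (fun z hz => by
      obtain ⟨p, q, hpq, -⟩ := ((hrel z).1 hz).2
      exact ⟨p, q, hpq⟩)
    (fun p hp => by
      obtain ⟨hpF, hpG⟩ := (ha p).1 hp
      obtain ⟨q, hq, hqG⟩ : ∃ q, Ch p q ∧ ¬ Good q := by
        by_contra! hne
        exact hpG (good_of p hne)
      obtain ⟨z, hz⟩ := h.exists_oPair p q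
      have hqF := hF p q hq
      exact ⟨q, (ha q).2 ⟨hqF, hqG⟩, z,
        (hrel z).2 ⟨hW z p q hpF hqF hz, p, q, hz, hq⟩, hz⟩)
  exact ⟨o, g, ho, ⟨hg.1, fun x y hxy => ((ha y).1 (hg.2 x y hxy)).1⟩, hg₀,
    fun n s y y' hn hs hy hy' => hrel' _ _ (hgs n s y y' hn hs hy hy')⟩

end IsZFminusDC

/-- `p` is (the graph of) a partial isomorphism from `M` to `N`. -/
def PartIso {V : Type u} (r : V → V → Prop) (M N p : V) : Prop :=
  (∀ z, r z p → ∃ a b, r a M ∧ r b N ∧ IsOPair r z a b) ∧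
  ∀ a b a' b', FApp r p a b → FApp r p a' b' → (a = a' ↔ b = b') ∧ (r a a' ↔ r b b')

/-- Every extension `p ∪ {⟨a, b⟩}` with a prescribed `a ∈ M`, or a prescribed `b ∈ N`, can be
chosen to satisfy `S`. -/
def ExtW {V : Type u} (r : V → V → Prop) (M N p : V) (S : V → Prop) : Prop :=
  (∀ a, r a M → ∃ b q, r b N ∧ AddPair r q p a b ∧ S q) ∧
  ∀ b, r b N → ∃ a q, r a M ∧ AddPair r q p a b ∧ S q

theorem ExtW.imp {V : Type u} {r : V → V → Prop} {M N p : V} {S T : V → Prop}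
    (hS : ExtW r M N p S) (hST : ∀ q, S q → T q) : ExtW r M N p T :=
  ⟨fun a ha => (hS.1 a ha).imp fun _ => Exists.imp fun q hq => ⟨hq.1, hq.2.1, hST q hq.2.2⟩,
    fun b hb => (hS.2 b hb).imp fun _ => Exists.imp fun q hq => ⟨hq.1, hq.2.1, hST q hq.2.2⟩⟩

/-- The condition on `R` expressing that the second player survives `k` rounds of the
back-and-forth game on `M`, `N` from the position `p`, as `R` records the later positions. -/
def GameStep {V : Type u} (r : V → V → Prop) (M N k p R : V) : Prop :=
  PartIso r M N p ∧ ∀ j, r j k → ExtW r M N p (FApp r R j)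

/-- The second player survives `k` rounds of the back-and-forth game on `M`, `N` from the
position `p`. -/
def Survives {V : Type u} (r : V → V → Prop) (M N k p : V) : Prop :=
  ∃ R, Cert r (GameStep r M N) R ∧ FApp r R k p

section

variable {Q : Type u} {r : Q → Q → Prop} {M N : Q}

instance Dfn₃.gameStep : Dfn₃ r (GameStep r M N) :=
  ⟨by intros; unfold GameStep PartIso ExtW; infer_instance⟩

instance Dfn₂.survives : Dfn₂ r (Survives r M N) :=
  ⟨by intros; unfold Survives; infer_instance⟩

theorem monoW_extW (p j : Q) : MonoW r fun R => ExtW r M N p (FApp r R j) :=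
  fun _ _ hR hs => hR.imp fun _ hq => hq.mono hs

theorem monoW_gameStep (k p : Q) : MonoW r (GameStep r M N k p) :=
  fun _ _ hR hs => ⟨hR.1, fun j hj => monoW_extW p j _ _ (hR.2 j hj) hs⟩

variable (h : IsZFminusDC r)
include h

theorem survives_iff {k p : Q} : Survives r M N k p ↔
    PartIso r M N p ∧ ∀ j, r j k → ExtW r M N p (Survives r M N j) := by
  constructor
  · rintro ⟨R, hR, hk⟩
    exact (hR k p hk).imp_right fun H j hj => (H j hj).imp fun q hq => ⟨R, hR, hq⟩
  · rintro ⟨hp, H⟩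
    obtain ⟨R, hR, hRk⟩ := h.cert_uniform monoW_gameStep k
      (fun j R => ExtW r M N p (FApp r R j))
      (hΨ := ⟨by intros; unfold ExtW; infer_instance⟩)
      (fun j => monoW_extW p j)
      (fun j hj => by
        obtain ⟨R, hR, hRM⟩ := h.cert_uniform monoW_gameStep M
          (fun a R => ∃ b q, r b N ∧ AddPair r q p a b ∧ FApp r R j q)
          (hΨ := ⟨by intros; infer_instance⟩)
          (fun a R R' hR hs => hR.imp fun b => Exists.imp fun q hq =>
            ⟨hq.1, hq.2.1, hq.2.2.mono hs⟩)
          (fun a ha => by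
            obtain ⟨b, q, hb, hq, R, hR, hjq⟩ := (H j hj).1 a ha
            exact ⟨R, hR, b, q, hb, hq, hjq⟩)
        obtain ⟨S, hS, hSN⟩ := h.cert_uniform monoW_gameStep N
          (fun b R => ∃ a q, r a M ∧ AddPair r q p a b ∧ FApp r R j q)
          (hΨ := ⟨by intros; infer_instance⟩)
          (fun b R R' hR hs => hR.imp fun a => Exists.imp fun q hq =>
            ⟨hq.1, hq.2.1, hq.2.2.mono hs⟩)
          (fun b hb => by
            obtain ⟨a, q, ha, hq, R, hR, hjq⟩ := (H j hj).2 b hb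
            exact ⟨R, hR, a, q, ha, hq, hjq⟩)
        obtain ⟨U, hU, hRU, hSU⟩ := h.cert_union monoW_gameStep hR hS
        exact ⟨U, hU,
          fun a ha => (hRM a ha).imp fun b => Exists.imp fun q hq =>
            ⟨hq.1, hq.2.1, hq.2.2.mono hRU⟩,
          fun b hb => (hSN b hb).imp fun a => Exists.imp fun q hq =>
            ⟨hq.1, hq.2.1, hq.2.2.mono hSU⟩⟩)
    obtain ⟨R', hR', -, hk⟩ := h.cert_insert monoW_gameStep hR ⟨hp, hRk⟩
    exact ⟨R', hR', hk⟩

theorem Survives.mono {k k' p : Q} (hp : Survives r M N k p) (hk : SubW r k' k) :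
    Survives r M N k' p := by
  rw [survives_iff h] at hp ⊢
  exact ⟨hp.1, fun j hj => hp.2 j (hk j hj)⟩

/-- There is a set containing `p₀` and closed under adding pairs from `M × N`. -/
theorem exists_closed_addPair (wf : WellFounded r) (M N p₀ : Q) :
    ∃ F, r p₀ F ∧ ∀ p q a b, r p F → r a M → r b N → AddPair r q p a b → r q F := by
  let Θ : Q → Q → Q → Prop := fun k p R => ∀ j, r j k → ∀ a, r a M → ∀ b, r b N →
    ∃ q, AddPair r q p a b ∧ FApp r R j q
  have hΘ : Dfn₃ r Θ := ⟨by intros; dsimp only [Θ]; infer_instance⟩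
  have mono : ∀ k p, MonoW r (Θ k p) := fun k p R R' hR hs j hj a ha b hb =>
    (hR j hj a ha b hb).imp fun q hq => ⟨hq.1, hq.2.mono hs⟩
  have key : ∀ k p, ∃ R, Cert r Θ R ∧ FApp r R k p := by
    intro k
    induction k using wf.induction with
    | _ k ih =>
    intro p
    obtain ⟨R, hR, hRk⟩ := h.cert_uniform mono k
      (fun j R => ∀ a, r a M → ∀ b, r b N → ∃ q, AddPair r q p a b ∧ FApp r R j q)
      (hΨ := ⟨by intros; infer_instance⟩)
      (fun j R R' hR hs a ha b hb => (hR a ha b hb).imp fun q hq => ⟨hq.1, hq.2.mono hs⟩)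
      (fun j hj => h.cert_uniform mono M
        (fun a R => ∀ b, r b N → ∃ q, AddPair r q p a b ∧ FApp r R j q)
        (hΨ := ⟨by intros; infer_instance⟩)
        (fun a R R' hR hs b hb => (hR b hb).imp fun q hq => ⟨hq.1, hq.2.mono hs⟩)
        (fun a _ => h.cert_uniform mono N
          (fun b R => ∃ q, AddPair r q p a b ∧ FApp r R j q)
          (hΨ := ⟨by intros; infer_instance⟩)
          (fun b R R' hR hs => hR.imp fun q hq => ⟨hq.1, hq.2.mono hs⟩)
          (fun b _ => by
            obtain ⟨q, hq⟩ := h.exists_addPair p a b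
            obtain ⟨R, hR, hjq⟩ := ih j hj q
            exact ⟨R, hR, q, hq, hjq⟩)))
    obtain ⟨R', hR', -, hk⟩ := h.cert_insert mono (k := k) (p := p) hR hRk
    exact ⟨R', hR', hk⟩
  obtain ⟨o, ho⟩ := h.infinity
  obtain ⟨R, hR, hRo⟩ := h.cert_uniform mono o (fun k R => FApp r R k p₀)
    (hΨ := ⟨by intros; infer_instance⟩) (fun k R R' hR hs => hR.mono hs) (fun k _ => key k p₀)
  obtain ⟨T, hT⟩ := h.exists_coords R
  obtain ⟨F, hF⟩ := h.sep T (fun p => ∀ k, r k o → FApp r R k p)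
  obtain ⟨k₀, hk₀⟩ := ho.1.2.1
  refine ⟨F, (hF p₀).2 ⟨(hT _ _ (hRo k₀ hk₀)).2, hRo⟩, fun p q a b hp ha hb hq => ?_⟩
  have hqo : ∀ k, r k o → FApp r R k q := by
    intro k hk
    obtain ⟨k', hk', hkk'⟩ := ho.1.2.2 k hk
    obtain ⟨q', hq', hRq⟩ := hR k' p (((hF p).1 hp).2 k' hk') k hkk' a ha b hb
    rwa [h.extensionality q q' fun z => (hq z).trans (hq' z).symm]
  exact (hF q).2 ⟨(hT _ _ (hqo k₀ hk₀)).2, hqo⟩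

end

/-- The structure `A` is isomorphic, via `e`, to the set `M` with the membership relation `r`. -/
structure Codes {Q : Type u} (r : Q → Q → Prop) (M : Q) {A : Type v} [L3.Structure A]
    (e : A → Q) : Prop where
  injective : Function.Injective e
  mem : ∀ a, r (e a) M
  surj : ∀ x, r x M → ∃ a, e a = x
  relMap_mem : ∀ w : Fin 2 → A,
    Structure.RelMap (L := L3) (show L3.Relations 2 from Rels.mem) w ↔ r (e (w 0)) (e (w 1))
  relMap_u1 : ∀ w : Fin 1 → A, ¬ Structure.RelMap (L := L3) (show L3.Relations 1 from Rels.u1) w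
  relMap_u2 : ∀ w : Fin 1 → A, ¬ Structure.RelMap (L := L3) (show L3.Relations 1 from Rels.u2) w

/-- `p` is the set of all pairs `⟨as i, bs i⟩`. -/
def Lists {Q : Type u} (r : Q → Q → Prop) (p : Q) {n : ℕ} (as bs : Fin n → Q) : Prop :=
  ∀ z, r z p ↔ ∃ i, IsOPair r z (as i) (bs i)

section

variable {Q : Type u} {r : Q → Q → Prop}

theorem Lists.fApp_iff (h : IsZFminusDC r) {p : Q} {n : ℕ} {as bs : Fin n → Q}
    (hp : Lists r p as bs) {x y : Q} : FApp r p x y ↔ ∃ i, x = as i ∧ y = bs i := by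
  constructor
  · rintro ⟨z, hz, hxy⟩
    exact ((hp z).1 hz).imp fun i hi => hxy.inj h.extensionality hi
  · rintro ⟨i, rfl, rfl⟩
    obtain ⟨z, hz⟩ := h.exists_oPair (as i) (bs i)
    exact ⟨z, (hp z).2 ⟨i, hz⟩, hz⟩

theorem Lists.snoc {p q : Q} {n : ℕ} {as bs : Fin n → Q} (hp : Lists r p as bs) {a b : Q}
    (hq : AddPair r q p a b) :
    Lists r q (Fin.snoc (α := fun _ => Q) as a) (Fin.snoc (α := fun _ => Q) bs b) := by
  intro z
  rw [hq z, hp z, Fin.exists_iff_castSucc]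
  simp [or_comm]

theorem Codes.relMap_iff {M N p : Q} {A : Type v} {B : Type v} [L3.Structure A]
    [L3.Structure B] {eA : A → Q} {eB : B → Q} (hA : Codes r M eA) (hB : Codes r N eB)
    (hp : PartIso r M N p) {l : ℕ} (R : L3.Relations l) (x : Fin l → A) (y : Fin l → B)
    (hxy : ∀ i, FApp r p (eA (x i)) (eB (y i))) :
    Structure.RelMap R x ↔ Structure.RelMap R y := by
  match l, (show Rels l from R) with
  | _, .u1 => exact iff_of_false (hA.relMap_u1 _) (hB.relMap_u1 _)
  | _, .u2 => exact iff_of_false (hA.relMap_u2 _) (hB.relMap_u2 _)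
  | _, .mem =>
    exact (hA.relMap_mem x).trans ((hp.2 _ _ _ _ (hxy 0) (hxy 1)).2.trans (hB.relMap_mem y).symm)

variable (h : IsZFminusDC r) {M N : Q} {A : Type v} {B : Type v} [L3.Structure A]
  [L3.Structure B] {eA : A → Q} {eB : B → Q} (hA : Codes r M eA) (hB : Codes r N eB)
include h hA hB

/-- Finite sequences satisfying the same atomic formulas yield a partial isomorphism. -/
theorem partIso_of_realize (n : ℕ) :
    ∃ (ι : Type) (_ : Finite ι) (Φ : ι → L3.BoundedFormula Empty n), ∀ as bs,
      (∀ i, (Φ i).Realize default as ↔ (Φ i).Realize default bs) →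
      ∀ p, Lists r p (eA ∘ as) (eB ∘ bs) → PartIso r M N p := by
  let t : Fin n → L3.Term (Empty ⊕ Fin n) := fun i => Term.var (Sum.inr i)
  refine ⟨(Fin n × Fin n) ⊕ (Fin n × Fin n), inferInstance, Sum.elim
    (fun i => (t i.1).bdEqual (t i.2))
    (fun i => Relations.boundedFormula₂ (L := L3) (show L3.Relations 2 from Rels.mem)
      (t i.1) (t i.2)), fun as bs H p hp => ⟨fun z hz => ?_, fun a b a' b' hab hab' => ?_⟩⟩
  · obtain ⟨i, hi⟩ := (hp z).1 hz
    exact ⟨_, _, hA.mem _, hB.mem _, hi⟩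
  · obtain ⟨i, rfl, rfl⟩ := (hp.fApp_iff h).1 hab
    obtain ⟨j, rfl, rfl⟩ := (hp.fApp_iff h).1 hab'
    have h1 := H (Sum.inl (i, j))
    have h2 := H (Sum.inr (i, j))
    have h2' := (BoundedFormula.realize_rel₂ (L := L3)).symm.trans
      (h2.trans (BoundedFormula.realize_rel₂ (L := L3)))
    rw [hA.relMap_mem, hB.relMap_mem] at h2'
    exact ⟨hA.injective.eq_iff.trans (h1.trans hB.injective.eq_iff.symm), h2'⟩

/-- Finite sequences satisfying the same formulas from a suitable finite family yield a position
from which the second player survives `k` rounds. -/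
theorem survives_of_realize (wf : WellFounded r) {o : Q} (ho : IsOmegaW r o) (k : Q) :
    r k o → ∀ n : ℕ, ∃ (ι : Type) (_ : Finite ι) (Φ : ι → L3.BoundedFormula Empty n),
      ∀ as bs, (∀ i, (Φ i).Realize default as ↔ (Φ i).Realize default bs) →
        ∀ p, Lists r p (eA ∘ as) (eB ∘ bs) → Survives r M N k p := by
  induction k using wf.induction with
  | _ k ih =>
  intro hk n
  rcases ho.empty_or_succ wf h.extensionality hk with hk₀ | ⟨m, hm, hmk, hs⟩
  · obtain ⟨ι, hι, Φ, hΦ⟩ := partIso_of_realize h hA hB n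
    exact ⟨ι, hι, Φ, fun as bs H p hp =>
      (survives_iff h).2 ⟨hΦ as bs H p hp, fun j hj => absurd hj (hk₀ j)⟩⟩
  · obtain ⟨ι, hι, Φ, hΦ⟩ := ih m hmk hm n
    obtain ⟨κ, hκ, Ψ, hΨ⟩ := ih m hmk hm (n + 1)
    classical
    let χ : Set κ → L3.BoundedFormula Empty n := fun S =>
      (BoundedFormula.iInf fun i => if i ∈ S then Ψ i else ∼(Ψ i)).ex
    have hχA : ∀ S (as : Fin n → A), (χ S).Realize default as ↔
        ∃ a, ∀ i, i ∈ S ↔ (Ψ i).Realize default (Fin.snoc (α := fun _ => A) as a) := by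
      intro S as
      simp only [χ, BoundedFormula.realize_ex, BoundedFormula.realize_iInf]
      refine exists_congr fun a => forall_congr' fun i => ?_
      by_cases hi : i ∈ S <;> simp [hi]
    have hχB : ∀ S (bs : Fin n → B), (χ S).Realize default bs ↔
        ∃ b, ∀ i, i ∈ S ↔ (Ψ i).Realize default (Fin.snoc (α := fun _ => B) bs b) := by
      intro S bs
      simp only [χ, BoundedFormula.realize_ex, BoundedFormula.realize_iInf]
      refine exists_congr fun a => forall_congr' fun i => ?_
      by_cases hi : i ∈ S <;> simp [hi]
    refine ⟨ι ⊕ Set κ, inferInstance, Sum.elim Φ χ, fun as bs H p hp => (survives_iff h).2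
      ⟨((survives_iff h).1 (hΦ as bs (fun i => H (Sum.inl i)) p hp)).1, fun j hj => ?_⟩⟩
    have hjm : SubW r j m := by
      rcases (hs j).1 hj with hj | rfl
      · exact fun z hz => (ho.1.1.of_mem hm).1 j z hj hz
      · exact fun z hz => hz
    have ext : ∀ a b, (∀ i, (Ψ i).Realize default (Fin.snoc (α := fun _ => A) as a) ↔
        (Ψ i).Realize default (Fin.snoc (α := fun _ => B) bs b)) → ∀ q,
        AddPair r q p (eA a) (eB b) → Survives r M N j q := by
      intro a b hab q hq
      refine (hΨ _ _ hab q ?_).mono h hjm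
      have := hp.snoc hq
      rwa [← Fin.comp_snoc, ← Fin.comp_snoc] at this
    constructor
    · intro a ha
      obtain ⟨a, rfl⟩ := hA.surj a ha
      obtain ⟨b, hb⟩ := (hχB {i | (Ψ i).Realize default (Fin.snoc (α := fun _ => A) as a)} bs).1
        ((H (Sum.inr _)).1 ((hχA _ as).2 ⟨a, fun i => Iff.rfl⟩))
      obtain ⟨q, hq⟩ := h.exists_addPair p (eA a) (eB b)
      exact ⟨_, q, hB.mem b, hq, ext a b hb q hq⟩
    · intro b hb
      obtain ⟨b, rfl⟩ := hB.surj b hb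
      obtain ⟨a, ha⟩ := (hχA {i | (Ψ i).Realize default (Fin.snoc (α := fun _ => B) bs b)} as).1
        ((H (Sum.inr _)).2 ((hχB _ bs).2 ⟨b, fun i => Iff.rfl⟩))
      obtain ⟨q, hq⟩ := h.exists_addPair p (eA a) (eB b)
      exact ⟨_, q, hA.mem a, hq, ext a b (fun i => (ha i).symm) q hq⟩

/-- The part of an elementary embedding on a finite sequence is a position from which the second
player survives any finite number of rounds. -/
theorem survives_of_elementaryEmbedding (wf : WellFounded r) {o : Q} (ho : IsOmegaW r o)
    (π : A ↪ₑ[L3] B) {n : ℕ} (as : Fin n → A) {p : Q} (hp : Lists r p (eA ∘ as) (eB ∘ π ∘ as))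
    {k : Q} (hk : r k o) : Survives r M N k p := by
  obtain ⟨ι, -, Φ, hΦ⟩ := survives_of_realize h hA hB wf ho k hk n
  refine hΦ as (π ∘ as) (fun i => ?_) p hp
  rw [← π.map_boundedFormula (Φ i) default as]
  exact iff_of_eq (congrArg₂ _ (Subsingleton.elim _ _) rfl)

/-- A position from which the second player survives sufficiently many rounds preserves a given
formula. -/
theorem realize_iff_of_survives (wf : WellFounded r) {o : Q} (ho : IsOmegaW r o) {α : Type}
    {n : ℕ} (φ : L3.BoundedFormula α n) : ∃ k, r k o ∧ ∀ p, Survives r M N k p →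
      ∀ (v : α → A) (w : α → B) (xs : Fin n → A) (ys : Fin n → B),
        (∀ i, FApp r p (eA (v i)) (eB (w i))) → (∀ i, FApp r p (eA (xs i)) (eB (ys i))) →
        (φ.Realize v xs ↔ φ.Realize w ys) := by
  have hterm : ∀ {n : ℕ} (t : L3.Term (α ⊕ Fin n)) {p : Q} {v : α → A} {w : α → B}
      {xs : Fin n → A} {ys : Fin n → B}, (∀ i, FApp r p (eA (v i)) (eB (w i))) →
      (∀ i, FApp r p (eA (xs i)) (eB (ys i))) →
      FApp r p (eA (t.realize (Sum.elim v xs))) (eB (t.realize (Sum.elim w ys))) := by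
    intro n t p v w xs ys hv hx
    match t with
    | .var (.inl i) => exact hv i
    | .var (.inr i) => exact hx i
    | .func f _ => exact nomatch (show Funcs _ from f)
  obtain ⟨k₀, hk₀⟩ := ho.1.2.1
  induction φ with
  | falsum => exact ⟨k₀, hk₀, fun _ _ _ _ _ _ _ _ => Iff.rfl⟩
  | equal t s =>
    refine ⟨k₀, hk₀, fun p hp v w xs ys hv hx => ?_⟩
    have := (((survives_iff h).1 hp).1.2 _ _ _ _ (hterm t hv hx) (hterm s hv hx)).1
    rwa [hA.injective.eq_iff, hB.injective.eq_iff] at this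
  | rel R ts =>
    refine ⟨k₀, hk₀, fun p hp v w xs ys hv hx => ?_⟩
    exact hA.relMap_iff hB ((survives_iff h).1 hp).1 R _ _ fun i => hterm (ts i) hv hx
  | imp φ ψ ihφ ihψ =>
    obtain ⟨k, hk, hφ⟩ := ihφ
    obtain ⟨l, hl, hψ⟩ := ihψ
    obtain ⟨m, hm, hkm, hlm⟩ : ∃ m, r m o ∧ SubW r k m ∧ SubW r l m := by
      rcases OrdW.trichotomy wf h.extensionality k l (ho.1.1.of_mem hk) (ho.1.1.of_mem hl)
        with hkl | rfl | hkl
      · exact ⟨l, hl, fun z hz => (ho.1.1.of_mem hl).1 k z hkl hz, fun z hz => hz⟩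
      · exact ⟨k, hk, fun z hz => hz, fun z hz => hz⟩
      · exact ⟨k, hk, fun z hz => hz, fun z hz => (ho.1.1.of_mem hk).1 l z hkl hz⟩
    refine ⟨m, hm, fun p hp v w xs ys hv hx => ?_⟩
    rw [BoundedFormula.realize_imp, BoundedFormula.realize_imp,
      hφ p (hp.mono h hkm) v w xs ys hv hx, hψ p (hp.mono h hlm) v w xs ys hv hx]
  | all φ ih =>
    obtain ⟨k, hk, hφ⟩ := ih
    obtain ⟨k', hk', hkk'⟩ := ho.1.2.2 k hk
    refine ⟨k', hk', fun p hp v w xs ys hv hx => ?_⟩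
    have hext := ((survives_iff h).1 hp).2 k hkk'
    have step : ∀ a b q, AddPair r q p (eA a) (eB b) → Survives r M N k q →
        (φ.Realize v (Fin.snoc xs a) ↔ φ.Realize w (Fin.snoc ys b)) := by
      intro a b q hq hqs
      refine hφ q hqs v w _ _ (fun i => (hv i).mono hq.subW) fun i => ?_
      refine Fin.lastCases ?_ (fun i => ?_) i
      · simpa using hq.fApp h
      · simpa using (hx i).mono hq.subW
    rw [BoundedFormula.realize_all, BoundedFormula.realize_all]
    constructor
    · intro H b
      obtain ⟨a, q, ha, hq, hqs⟩ := hext.2 (eB b) (hB.mem b)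
      obtain ⟨a, rfl⟩ := hA.surj a ha
      exact (step a b q hq hqs).1 (H a)
    · intro H a
      obtain ⟨b, q, hb, hq, hqs⟩ := hext.1 (eA a) (hA.mem a)
      obtain ⟨b, rfl⟩ := hB.surj b hb
      exact (step a b q hq hqs).2 (H b)

end

/-- From the position `p` one can pass to the position `q`, which extends `p`, is defined at the
first element of `M` (according to `f`) missing from the domain of `p`, and from which the second
player survives any number `k ∈ o` of rounds. -/
def Child {V : Type u} (r : V → V → Prop) (M N o f F p q : V) : Prop :=
  r q F ∧ (∀ k, r k o → Survives r M N k q) ∧ SubW r p q ∧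
    ∀ m, r m M →
      (∀ m', r m' M → (∃ i i', FApp r f m i ∧ FApp r f m' i' ∧ r i' i) → ∃ b, FApp r p m' b) →
      ∃ b, FApp r q m b

section

variable {Q : Type u} {r : Q → Q → Prop} {M N : Q}

instance Dfn₂.child (o f F : Q) : Dfn₂ r (Child r M N o f F) where
  out := by
    have := @(Dfn₂.survives (r := r) (M := M) (N := N)).out
    intros
    unfold Child
    infer_instance

variable (h : IsZFminusDC r)
include h

theorem exists_lists {n : ℕ} (as bs : Fin n → Q) : ∃ p, Lists r p as bs := by
  induction n with
  | zero => exact h.exists_empty.imp fun e he z => by simpa using he z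
  | succ n ih =>
    obtain ⟨p, hp⟩ := ih (Fin.init as) (Fin.init bs)
    obtain ⟨q, hq⟩ := h.exists_addPair p (as (Fin.last n)) (bs (Fin.last n))
    have := hp.snoc hq
    rw [Fin.snoc_init_self, Fin.snoc_init_self] at this
    exact ⟨q, this⟩

variable {A : Type v} {B : Type v} [L3.Structure A] [L3.Structure B] {eA : A → Q} {eB : B → Q}
  (hA : Codes r M eA) (hB : Codes r N eB)
include hA hB

/-- A finite part `p` of an elementary embedding has a `Child` which is a finite part, too. -/
theorem exists_child (wf : WellFounded r) {o f F : Q} (ho : IsOmegaW r o) (hf : IsInjW r f M o)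
    (hF : ∀ p q a b, r p F → r a M → r b N → AddPair r q p a b → r q F) (π : A ↪ₑ[L3] B)
    {n : ℕ} (as : Fin n → A) {p : Q} (hpF : r p F) (hp : Lists r p (eA ∘ as) (eB ∘ π ∘ as)) :
    ∃ q, Child r M N o f F p q ∧ r q F ∧
      ∃ (m : ℕ) (as' : Fin m → A), Lists r q (eA ∘ as') (eB ∘ π ∘ as') := by
  by_cases htot : ∀ m, r m M → ∃ b, FApp r p m b
  · exact ⟨p, ⟨hpF, fun k hk => survives_of_elementaryEmbedding h hA hB wf ho π as hp hk,
      fun z hz => hz, fun m hm _ => htot m hm⟩, hpF, n, as, hp⟩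
  push Not at htot
  obtain ⟨m₀, hm₀, hm₀p⟩ := htot
  obtain ⟨i₀, hi₀⟩ := hf.1.1.2.1 m₀ hm₀
  obtain ⟨i, ⟨m, hm, hmi, hmp⟩, hmin⟩ := wf.has_min
    {i | ∃ m, r m M ∧ FApp r f m i ∧ ∀ b, ¬ FApp r p m b} ⟨i₀, m₀, hm₀, hi₀, hm₀p⟩
  obtain ⟨a, rfl⟩ := hA.surj m hm
  obtain ⟨q, hq⟩ := h.exists_addPair p (eA a) (eB (π a))
  have hqF : r q F := hF p q _ _ hpF hm (hB.mem _) hq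
  have hqL : Lists r q (eA ∘ Fin.snoc (α := fun _ => A) as a)
      (eB ∘ π ∘ Fin.snoc (α := fun _ => A) as a) := by
    have := hp.snoc hq
    rwa [← Fin.comp_snoc, ← Fin.comp_snoc, ← Fin.comp_snoc] at this
  refine ⟨q, ⟨hqF, fun k hk => survives_of_elementaryEmbedding h hA hB wf ho π _ hqL hk,
    hq.subW, fun m₁ hm₁ H => ?_⟩, hqF, _, _, hqL⟩
  by_cases hm₁p : ∃ b, FApp r p m₁ b
  · exact hm₁p.imp fun b hb => hb.mono hq.subW
  push Not at hm₁p
  obtain ⟨i₁, hi₁⟩ := hf.1.1.2.1 m₁ hm₁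
  rcases OrdW.trichotomy wf h.extensionality i i₁ (ho.1.1.of_mem (hf.1.2 _ _ hmi))
    (ho.1.1.of_mem (hf.1.2 _ _ hi₁)) with hii | rfl | hii
  · obtain ⟨b, hb⟩ := H (eA a) hm ⟨i₁, i, hi₁, hmi, hii⟩
    exact absurd hb (hmp b)
  · obtain rfl := hf.2 _ _ _ hmi hi₁
    exact ⟨_, hq.fApp h⟩
  · exact absurd hii (hmin i₁ ⟨m₁, hm₁, hi₁, hm₁p⟩)

/-- There is an internal chain of partial isomorphisms, all extending a given finite part `p₀` of
an elementary embedding and preserving all formulas, whose union is defined on all of `M`. -/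
theorem exists_chain (wf : WellFounded r) {o f : Q} (ho : IsOmegaW r o) (hf : IsInjW r f M o)
    (π : A ↪ₑ[L3] B) {n : ℕ} (as : Fin n → A) {p₀ : Q}
    (hp₀ : Lists r p₀ (eA ∘ as) (eB ∘ π ∘ as)) :
    ∃ C, (∃ p, r p C) ∧
      (∀ p, r p C → SubW r p₀ p ∧ ∀ k, r k o → Survives r M N k p) ∧
      (∀ p p', r p C → r p' C → SubW r p p' ∨ SubW r p' p) ∧
      ∀ m, r m M → ∃ p b, r p C ∧ FApp r p m b := by
  obtain ⟨F, hp₀F, hF⟩ := exists_closed_addPair h wf M N p₀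
  obtain ⟨o', g, ho', hg, hg₀, hgs⟩ := h.exists_branch wf (Child r M N o f F) F
    (fun p q hpq => hpq.1)
    (fun p => r p F ∧ ∃ (m : ℕ) (as : Fin m → A), Lists r p (eA ∘ as) (eB ∘ π ∘ as)) p₀
    ⟨hp₀F, n, as, hp₀⟩ hp₀F
    (fun p ⟨hpF, m, as', hp⟩ => exists_child h hA hB wf ho hf hF π as' hpF hp)
  obtain rfl := ho'.unique wf h.extensionality ho
  have key : ∀ n, r n o' → ∀ p, FApp r g n p → SubW r p₀ p ∧
      (∀ k, r k o' → Survives r M N k p) ∧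
      (∀ n' p', r n' n → FApp r g n' p' → SubW r p' p) ∧
      ∀ m i, r m M → r i n → FApp r f m i → ∃ b, FApp r p m b := by
    intro n
    induction n using wf.induction with
    | _ n ih =>
    intro hn p hp
    rcases ho.empty_or_succ wf h.extensionality hn with hn₀ | ⟨l, hl, hln, hs⟩
    · obtain rfl := hg.1.2.2 _ _ _ hp (hg₀ n hn₀)
      exact ⟨fun z hz => hz,
        fun k hk => survives_of_elementaryEmbedding h hA hB wf ho π as hp₀ hk,
        fun n' p' hn' => absurd hn' (hn₀ n'), fun m i _ hi => absurd hi (hn₀ i)⟩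
    · obtain ⟨pl, hpl⟩ := hg.1.2.1 l hl
      obtain ⟨ih₁, -, ih₃, ih₄⟩ := ih l hln hl pl hpl
      obtain ⟨-, hsurv, hsub, hdom⟩ := hgs l n pl p hl hs hpl hp
      refine ⟨fun z hz => hsub z (ih₁ z hz), hsurv, fun n' p' hn' hp' => ?_, fun m i hm hi hmi => ?_⟩
      · rcases (hs n').1 hn' with hn' | rfl
        · exact fun z hz => hsub z (ih₃ n' p' hn' hp' z hz)
        · obtain rfl := hg.1.2.2 _ _ _ hp' hpl
          exact hsub
      · rcases (hs i).1 hi with hi | rfl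
        · exact (ih₄ m i hm hi hmi).imp fun b hb => hb.mono hsub
        · refine hdom m hm fun m' hm' ⟨j, j', hj, hj', hjj⟩ => ?_
          obtain rfl := hf.1.1.2.2 _ _ _ hj hmi
          exact ih₄ m' j' hm' hjj hj'
  obtain ⟨C, hC⟩ := h.sep F (fun p => ∃ n, r n o' ∧ FApp r g n p)
  have hC' : ∀ n p, r n o' → FApp r g n p → r p C := fun n p hn hp =>
    (hC p).2 ⟨hg.2 n p hp, n, hn, hp⟩
  refine ⟨C, ?_, fun p hp => ?_, fun p p' hp hp' => ?_, fun m hm => ?_⟩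
  · obtain ⟨n, hn⟩ := ho.1.2.1
    obtain ⟨p, hp⟩ := hg.1.2.1 n hn
    exact ⟨p, hC' n p hn hp⟩
  · obtain ⟨n, hn, hnp⟩ := ((hC p).1 hp).2
    exact ⟨(key n hn p hnp).1, (key n hn p hnp).2.1⟩
  · obtain ⟨n, hn, hnp⟩ := ((hC p).1 hp).2
    obtain ⟨n', hn', hnp'⟩ := ((hC p').1 hp').2
    rcases OrdW.trichotomy wf h.extensionality n n' (ho.1.1.of_mem hn) (ho.1.1.of_mem hn')
      with hnn | rfl | hnn
    · exact Or.inl ((key n' hn' p' hnp').2.2.1 n p hnn hnp)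
    · obtain rfl := hg.1.2.2 _ _ _ hnp hnp'
      exact Or.inl fun z hz => hz
    · exact Or.inr ((key n hn p hnp).2.2.1 n' p' hnn hnp')
  · obtain ⟨i, hi⟩ := hf.1.1.2.1 m hm
    obtain ⟨n, hn, hin⟩ := ho.1.2.2 i (hf.1.2 m i hi)
    obtain ⟨p, hp⟩ := hg.1.2.1 n hn
    obtain ⟨b, hb⟩ := (key n hn p hp).2.2.2 m i hm hin hi
    exact ⟨p, b, hC' n p hn hp, hb⟩

/-- Countable embedding absoluteness for abstract models: if the model `(Q, r)` of `ZF⁻ + DC`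
sees that `M` is countable, then it has an elementary embedding of `M` into `N` agreeing with a
given external one on a given finite sequence. -/
theorem exists_internal_elementaryEmbedding (wf : WellFounded r) {o f : Q} (ho : IsOmegaW r o)
    (hf : IsInjW r f M o) (π : A ↪ₑ[L3] B) {n : ℕ} (as : Fin n → A) :
    ∃ p, IsFuncW r p M N ∧ ∃ σ : A ↪ₑ[L3] B,
      (∀ a, FApp r p (eA a) (eB (σ a))) ∧ ∀ i, σ (as i) = π (as i) := by
  obtain ⟨p₀, hp₀⟩ := exists_lists h (eA ∘ as) (eB ∘ π ∘ as)
  obtain ⟨C, ⟨c₀, hc₀⟩, hC, hchain, htot⟩ := exists_chain h hA hB wf ho hf π as hp₀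
  have hiso : ∀ p, r p C → PartIso r M N p := fun p hp => by
    obtain ⟨k, hk⟩ := ho.1.2.1
    exact ((survives_iff h).1 ((hC p hp).2 k hk)).1
  have hmem : ∀ p x y, r p C → FApp r p x y → r x M ∧ r y N := by
    rintro p x y hp ⟨z, hz, hxy⟩
    obtain ⟨a, b, ha, hb, hab⟩ := (hiso p hp).1 z hz
    obtain ⟨rfl, rfl⟩ := hxy.inj h.extensionality hab
    exact ⟨ha, hb⟩
  have huniq : ∀ p p' x y y', r p C → r p' C → FApp r p x y → FApp r p' x y' → y = y' := by
    intro p p' x y y' hp hp' hy hy'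
    rcases hchain p p' hp hp' with hs | hs
    · exact ((hiso p' hp').2 _ _ _ _ (hy.mono hs) hy').1.1 rfl
    · exact ((hiso p hp).2 _ _ _ _ hy (hy'.mono hs)).1.1 rfl
  have hex : ∀ a, ∃ (b : B) (p : {p // r p C}), FApp r p.1 (eA a) (eB b) := by
    intro a
    obtain ⟨p, y, hp, hy⟩ := htot (eA a) (hA.mem a)
    obtain ⟨b, rfl⟩ := hB.surj y (hmem p _ _ hp hy).2
    exact ⟨b, ⟨p, hp⟩, hy⟩
  choose σ P hσ using hex
  obtain ⟨Z, hZ⟩ := h.unions C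
  have hZ' : ∀ x y, FApp r Z x y ↔ ∃ p, r p C ∧ FApp r p x y := by
    intro x y
    constructor
    · rintro ⟨z, hz, hxy⟩
      obtain ⟨p, hp, hzp⟩ := (hZ z).1 hz
      exact ⟨p, hp, z, hzp, hxy⟩
    · rintro ⟨p, hp, z, hz, hxy⟩
      exact ⟨z, (hZ z).2 ⟨p, hp, hz⟩, hxy⟩
  refine ⟨Z, ⟨⟨fun z hz => ?_, fun x hx => ?_, fun x y y' hy hy' => ?_⟩, fun x y hxy => ?_⟩,
    ⟨σ, fun m φ x => ?_⟩, fun a => (hZ' _ _).2 ⟨(P a).1, (P a).2, hσ a⟩, fun i => ?_⟩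
  · obtain ⟨p, hp, hzp⟩ := (hZ z).1 hz
    obtain ⟨a, b, ha, -, hab⟩ := (hiso p hp).1 z hzp
    exact ⟨a, b, ha, hab⟩
  · obtain ⟨p, b, hp, hb⟩ := htot x hx
    exact ⟨b, (hZ' x b).2 ⟨p, hp, hb⟩⟩
  · obtain ⟨p, hp, hpy⟩ := (hZ' _ _).1 hy
    obtain ⟨p', hp', hpy'⟩ := (hZ' _ _).1 hy'
    exact huniq p p' x y y' hp hp' hpy hpy'
  · obtain ⟨p, hp, hpy⟩ := (hZ' _ _).1 hxy
    exact (hmem p x y hp hpy).2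
  · have : Nonempty {p // r p C} := ⟨⟨c₀, hc₀⟩⟩
    have : IsTrans Q (SubW r) := ⟨fun a b c hab hbc z hz => hbc z (hab z hz)⟩
    have hdir : Directed (SubW r) (Subtype.val : {p // r p C} → Q) := fun p p' => by
      rcases hchain p p' p.2 p'.2 with hs | hs
      · exact ⟨p', hs, fun z hz => hz⟩
      · exact ⟨p, fun z hz => hz, hs⟩
    obtain ⟨q, hq⟩ := hdir.finite_le (P ∘ x)
    obtain ⟨k, hk, hφ⟩ := realize_iff_of_survives h hA hB wf ho φ
    exact (hφ q ((hC q q.2).2 k hk) x (σ ∘ x) default default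
      (fun i => (hσ (x i)).mono (hq i)) (fun i => i.elim0)).symm
  · exact hB.injective (huniq _ c₀ _ _ _ (P (as i)).2 hc₀ (hσ (as i))
      (((hp₀.fApp_iff h).2 ⟨i, rfl, rfl⟩ : FApp r p₀ _ _).mono (hC c₀ hc₀).1))

end

section Absoluteness

variable {V : Type u} {r : V → V → Prop} {P : V → Prop}
  (hP : ∀ x y, P x → r y x → P y)
include hP

theorem isUPair_subtype {p a b : {x // P x}} :
    IsUPair (fun a b : {x // P x} => r a.1 b.1) p a b ↔ IsUPair r p.1 a.1 b.1 := by
  constructor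
  · intro H x
    constructor
    · intro hx
      simpa [Subtype.ext_iff] using (H ⟨x, hP _ _ p.2 hx⟩).1 hx
    · rintro (rfl | rfl)
      · exact (H a).2 (Or.inl rfl)
      · exact (H b).2 (Or.inr rfl)
  · intro H x
    simpa [Subtype.ext_iff] using H x.1

theorem isOPair_subtype {p a b : {x // P x}} :
    IsOPair (fun a b : {x // P x} => r a.1 b.1) p a b ↔ IsOPair r p.1 a.1 b.1 := by
  constructor
  · rintro ⟨s, t, hs, ht, hp⟩
    exact ⟨s, t, (isUPair_subtype hP).1 hs, (isUPair_subtype hP).1 ht, (isUPair_subtype hP).1 hp⟩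
  · rintro ⟨s, t, hs, ht, hp⟩
    have hsP : P s := hP _ _ p.2 ((hp s).2 (Or.inl rfl))
    have htP : P t := hP _ _ p.2 ((hp t).2 (Or.inr rfl))
    exact ⟨⟨s, hsP⟩, ⟨t, htP⟩, (isUPair_subtype hP).2 hs, (isUPair_subtype hP).2 ht,
      (isUPair_subtype hP).2 hp⟩

theorem fApp_subtype {f x y : {x // P x}} :
    FApp (fun a b : {x // P x} => r a.1 b.1) f x y ↔ FApp r f.1 x.1 y.1 := by
  constructor
  · rintro ⟨z, hz, hxy⟩
    exact ⟨z, hz, (isOPair_subtype hP).1 hxy⟩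
  · rintro ⟨z, hz, hxy⟩
    exact ⟨⟨z, hP _ _ f.2 hz⟩, hz, (isOPair_subtype hP).2 hxy⟩

theorem IsOPair.of_mem {p a b : V} (h : IsOPair r p a b) (hp : P p) : P a ∧ P b := by
  obtain ⟨s, t, -, ht, hst⟩ := h
  have htP : P t := hP _ _ hp ((hst t).2 (Or.inr rfl))
  exact ⟨hP _ _ htP ((ht a).2 (Or.inl rfl)), hP _ _ htP ((ht b).2 (Or.inr rfl))⟩

theorem FApp.of_mem {f x y : V} (h : FApp r f x y) (hf : P f) : P x ∧ P y := by
  obtain ⟨z, hz, hxy⟩ := h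
  exact hxy.of_mem hP (hP _ _ hf hz)

theorem isFuncW_subtype {f a b : {x // P x}} :
    IsFuncW (fun a b : {x // P x} => r a.1 b.1) f a b ↔ IsFuncW r f.1 a.1 b.1 := by
  constructor
  · rintro ⟨⟨h1, h2, h3⟩, h4⟩
    refine ⟨⟨fun z hz => ?_, fun x hx => ?_, fun x y y' hy hy' => ?_⟩, fun x y hxy => ?_⟩
    · obtain ⟨x, y, hx, hxy⟩ := h1 ⟨z, hP _ _ f.2 hz⟩ hz
      exact ⟨x, y, hx, (isOPair_subtype hP).1 hxy⟩
    · obtain ⟨y, hy⟩ := h2 ⟨x, hP _ _ a.2 hx⟩ hx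
      exact ⟨y, (fApp_subtype hP).1 hy⟩
    · obtain ⟨hx, hyP⟩ := hy.of_mem hP f.2
      have hyP' := (hy'.of_mem hP f.2).2
      exact congrArg Subtype.val
        (h3 ⟨x, hx⟩ ⟨y, hyP⟩ ⟨y', hyP'⟩ ((fApp_subtype hP).2 hy) ((fApp_subtype hP).2 hy'))
    · obtain ⟨hx, hy⟩ := hxy.of_mem hP f.2
      exact h4 ⟨x, hx⟩ ⟨y, hy⟩ ((fApp_subtype hP).2 hxy)
  · rintro ⟨⟨h1, h2, h3⟩, h4⟩
    refine ⟨⟨fun z hz => ?_, fun x hx => ?_, fun x y y' hy hy' => ?_⟩, fun x y hxy => ?_⟩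
    · obtain ⟨x, y, hx, hxy⟩ := h1 z hz
      obtain ⟨hxP, hyP⟩ := hxy.of_mem hP z.2
      exact ⟨⟨x, hxP⟩, ⟨y, hyP⟩, hx, (isOPair_subtype hP).2 hxy⟩
    · obtain ⟨y, hy⟩ := h2 x hx
      exact ⟨⟨y, (hy.of_mem hP f.2).2⟩, (fApp_subtype hP).2 hy⟩
    · exact Subtype.ext (h3 x y y' ((fApp_subtype hP).1 hy) ((fApp_subtype hP).1 hy'))
    · exact h4 x y ((fApp_subtype hP).1 hxy)

theorem transW_subtype {a : {x // P x}} :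
    TransW (fun a b : {x // P x} => r a.1 b.1) a ↔ TransW r a.1 :=
  ⟨fun H x y hx hy => H ⟨x, hP _ _ a.2 hx⟩ ⟨y, hP _ _ (hP _ _ a.2 hx) hy⟩ hx hy,
    fun H x y hx hy => H x y hx hy⟩

theorem ordW_subtype {a : {x // P x}} :
    OrdW (fun a b : {x // P x} => r a.1 b.1) a ↔ OrdW r a.1 :=
  and_congr (transW_subtype hP)
    ⟨fun H x hx => (transW_subtype hP).1 (H ⟨x, hP _ _ a.2 hx⟩ hx),
      fun H x hx => (transW_subtype hP).2 (H x hx)⟩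

theorem limitOrdW_subtype {a : {x // P x}} :
    LimitOrdW (fun a b : {x // P x} => r a.1 b.1) a ↔ LimitOrdW r a.1 := by
  refine and_congr (ordW_subtype hP) (and_congr ⟨?_, ?_⟩ ⟨?_, ?_⟩)
  · exact fun ⟨x, hx⟩ => ⟨x, hx⟩
  · exact fun ⟨x, hx⟩ => ⟨⟨x, hP _ _ a.2 hx⟩, hx⟩
  · intro H x hx
    obtain ⟨y, hy⟩ := H ⟨x, hP _ _ a.2 hx⟩ hx
    exact ⟨y, hy⟩
  · intro H x hx
    obtain ⟨y, hy⟩ := H x hx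
    exact ⟨⟨y, hP _ _ a.2 hy.1⟩, hy⟩

theorem isOmegaW_subtype {a : {x // P x}} :
    IsOmegaW (fun a b : {x // P x} => r a.1 b.1) a ↔ IsOmegaW r a.1 :=
  and_congr (limitOrdW_subtype hP)
    ⟨fun H x hx => fun hl => H ⟨x, hP _ _ a.2 hx⟩ hx ((limitOrdW_subtype hP).2 hl),
      fun H x hx hl => H x hx ((limitOrdW_subtype hP).1 hl)⟩

/-- The members of a set `M` in a transitive class form a structure coded by `M`. -/
theorem codes_subtype (M : {x // P x}) :
    @Codes _ (fun a b : {x // P x} => r a.1 b.1) M {x // r x M.1}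
      (mstr (r · M.1) r (fun _ => False) (fun _ => False))
      (fun x => ⟨x.1, hP _ _ M.2 x.2⟩) :=
  let _ := mstr (r · M.1) r (fun _ => False) (fun _ => False)
  { injective := fun _ _ hab => Subtype.ext (congrArg (fun z : {x // P x} => z.1) hab)
    mem := fun a => a.2
    surj := fun x hx => ⟨⟨x.1, hx⟩, rfl⟩
    relMap_mem := fun _ => Iff.rfl
    relMap_u1 := fun _ hw => hw
    relMap_u2 := fun _ hw => hw }

end Absoluteness

/-- **Countable Embedding Absoluteness** (Lemma 2.1). Let `M` and `N` be transitive sets,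
with `M` countable, and let `π : M → N` be an elementary embedding. Let `P` be a
transitive class with `M, N ∈ P` such that `P ⊨ ZF⁻ + DC + "M is countable"`. Then `P`
contains an elementary embedding `π* : M → N` (an element `p` of `P` whose
externalization `πs` is elementary) which agrees with `π` on any desired finite set `l`
and on the critical point of `π`, if it exists. -/
theorem countable_embedding_absoluteness (u : ZFUniv.{u})
    (M N : u.V) (hMt : TransW u.mem M) (hNt : TransW u.mem N) (hMc : CountableW u.mem M)
    (π : ElemEmb (u.mem · M) u.mem (fun _ => False) (fun _ => False)
      (u.mem · N) u.mem (fun _ => False) (fun _ => False))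
    (P : u.V → Prop) (hPtrans : ∀ x y, P x → u.mem y x → P y) (hMP : P M) (hNP : P N)
    (hPzf : IsZFminusDC (fun a b : {x : u.V // P x} => u.mem a.1 b.1))
    (hPMc : ∃ o f, P o ∧ P f ∧ IsOmegaW u.mem o ∧ IsInjW u.mem f M o)
    (l : List u.V) (hl : ∀ x ∈ l, u.mem x M) :
    ∃ p, P p ∧ IsFuncW u.mem p M N ∧
      ∃ πs : ElemEmb (u.mem · M) u.mem (fun _ => False) (fun _ => False)
        (u.mem · N) u.mem (fun _ => False) (fun _ => False),
        (∀ x (hx : u.mem x M), FApp u.mem p x (eApp πs ⟨x, hx⟩).1) ∧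
        (∀ x (hx : u.mem x M), x ∈ l → eApp πs ⟨x, hx⟩ = eApp π ⟨x, hx⟩) ∧
        (∀ κ (hκ : u.mem κ M), OrdW u.mem κ →
          (∀ α (hα : u.mem α M), u.mem α κ → (eApp π ⟨α, hα⟩).1 = α) →
          (eApp π ⟨κ, hκ⟩).1 ≠ κ →
          eApp πs ⟨κ, hκ⟩ = eApp π ⟨κ, hκ⟩) := by
  have hP := hPtrans
  obtain ⟨o, f, hoP, hfP, ho, hf⟩ := hPMc
  have wf : WellFounded (fun a b : {x : u.V // P x} => u.mem a.1 b.1) :=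
    InvImage.wf Subtype.val u.wf
  let IsCrit : {x // u.mem x M} → Prop := fun κ => OrdW u.mem κ.1 ∧
    (∀ α (hα : u.mem α M), u.mem α κ.1 → (eApp π ⟨α, hα⟩).1 = α) ∧ (eApp π κ).1 ≠ κ.1
  have hcrit : ∀ κ κ', IsCrit κ → IsCrit κ' → κ = κ' := by
    rintro κ κ' ⟨h1, h2, h3⟩ ⟨h1', h2', h3'⟩
    rcases OrdW.trichotomy u.wf u.extensionality κ.1 κ'.1 h1 h1' with hk | hk | hk
    · exact absurd (h2' κ.1 κ.2 hk) h3
    · exact Subtype.ext hk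
    · exact absurd (h2 κ'.1 κ'.2 hk) h3'
  obtain ⟨l', hl', hl'c⟩ : ∃ l' : List {x // u.mem x M},
      (∀ x (hx : u.mem x M), x ∈ l → ⟨x, hx⟩ ∈ l') ∧ ∀ κ, IsCrit κ → κ ∈ l' := by
    have h₀ : ∀ x (hx : u.mem x M), x ∈ l →
        (⟨x, hx⟩ : {x // u.mem x M}) ∈ l.attach.map fun x => ⟨x.1, hl x.1 x.2⟩ := by
      intro x hx hxl
      exact List.mem_map.2 ⟨⟨x, hxl⟩, List.mem_attach _ _, rfl⟩
    by_cases hex : ∃ κ, IsCrit κ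
    · obtain ⟨κ, hκ⟩ := hex
      exact ⟨κ :: _, fun x hx hxl => List.mem_cons_of_mem _ (h₀ x hx hxl),
        fun κ' hκ' => hcrit κ' κ hκ' hκ ▸ List.mem_cons_self⟩
    · exact ⟨_, h₀, fun κ hκ => absurd ⟨κ, hκ⟩ hex⟩
  obtain ⟨p, hp, σ, hσ, hσπ⟩ :=
    @exists_internal_elementaryEmbedding _ _ ⟨M, hMP⟩ ⟨N, hNP⟩ hPzf _ _
      (mstr (u.mem · M) u.mem (fun _ => False) (fun _ => False))
      (mstr (u.mem · N) u.mem (fun _ => False) (fun _ => False)) _ _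
      (codes_subtype hP ⟨M, hMP⟩) (codes_subtype hP ⟨N, hNP⟩) wf ⟨o, hoP⟩ ⟨f, hfP⟩
      ((isOmegaW_subtype hP).2 ho)
      ⟨(isFuncW_subtype hP).2 hf.1, fun x x' y hx hx' => Subtype.ext
        (hf.2 x x' y ((fApp_subtype hP).1 hx) ((fApp_subtype hP).1 hx'))⟩ π l'.length l'.get
  have hagree : ∀ x ∈ l', eApp σ x = eApp π x := by
    intro x hx
    obtain ⟨i, rfl⟩ := List.get_of_mem hx
    exact hσπ i
  exact ⟨p.1, p.2, (isFuncW_subtype hP).1 hp, σ, fun x hx => (fApp_subtype hP).1 (hσ ⟨x, hx⟩),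
    fun x hx hxl => hagree _ (hl' x hx hxl),
    fun κ hκ h1 h2 h3 => hagree _ (hl'c ⟨κ, hκ⟩ ⟨h1, h2, h3⟩)⟩

end VLC
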